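/- arXiv:1609.06247 — 2 statements merged into one kernel-verified Lean document; each statement's English description precedes it below -/
import Mathlib

section
/- Let 𝓛 ⊂ ℂ be a lattice, ω a half-period (2ω ∈ 𝓛), m a positive integer, and z₀ ∈ ℂ such that the line z = ωx + z₀, x ∈ ℝ, contains no lattice points. Then the spectrum of the complex Lamé operator L = −d²/dx² + m(m+1)ω²℘(ωx+z₀) in L²(ℝ) does not depend on the value of z₀: it equals the set of λ = λ(k₁,…,k_m) for which Re[f_m(λ)] = 0, where f_m(λ) = ζ(ω)·Σ_{j=1}^m k_j − ω·Σ_{j=1}^m ζ(k_j) and k₁,…,k_m are the auxiliary parameters of Hermite's solutions, a condition manifestly independent of z₀. -/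
open Complex Set Filter

noncomputable section

/-- The period lattice with half-periods `w1`, `w3`, i.e. the set of all
`2 m w1 + 2 n w3` with `m n : ℤ`. -/
def latticeSet (w1 w3 : ℂ) : Set ℂ := {z | ∃ m n : ℤ, z = 2 * m * w1 + 2 * n * w3}

/-- Weierstrass data for a lattice `𝓛` with basic half-periods `w1`, `w3`:
the functions `℘` (denoted `P`), `ζ` (denoted `Z`) and `σ` (denoted `S`),
characterized up to uniqueness by their standard analytic properties:
`℘` is `𝓛`-periodic, holomorphic off `𝓛`, with `℘(z) - 1/z² → 0` as `z → 0`;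
`ζ` is odd with `ζ' = -℘`; `σ` is entire, non-vanishing off `𝓛`, with
`σ'/σ = ζ` and `σ(z)/z → 1` as `z → 0`. -/
structure WeierstrassData where
  w1 : ℂ
  w3 : ℂ
  P : ℂ → ℂ
  Z : ℂ → ℂ
  S : ℂ → ℂ
  w1_ne : w1 ≠ 0
  indep : ∀ r : ℝ, w3 ≠ (r : ℂ) * w1
  P_diff : ∀ z ∉ latticeSet w1 w3, DifferentiableAt ℂ P z
  P_periodic : ∀ w ∈ latticeSet w1 w3, ∀ z, P (z + w) = P z
  P_pole : Tendsto (fun z => P z - 1 / z ^ 2) (nhdsWithin 0 {(0 : ℂ)}ᶜ) (nhds 0)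
  Z_diff : ∀ z ∉ latticeSet w1 w3, DifferentiableAt ℂ Z z
  Z_deriv : ∀ z ∉ latticeSet w1 w3, deriv Z z = -P z
  Z_odd : ∀ z, Z (-z) = -Z z
  S_diff : Differentiable ℂ S
  S_ne : ∀ z ∉ latticeSet w1 w3, S z ≠ 0
  S_deriv : ∀ z ∉ latticeSet w1 w3, deriv S z = Z z * S z
  S_norm : Tendsto (fun z => S z / z) (nhdsWithin 0 {(0 : ℂ)}ᶜ) (nhds 1)

namespace WeierstrassData

variable (W : WeierstrassData)

/-- The period lattice of `W`. -/
def lattice : Set ℂ := latticeSet W.w1 W.w3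

/-- The third basic half-period `ω₂ = ω₁ + ω₃`. -/
def w2 : ℂ := W.w1 + W.w3

/-- `e₁ = ℘(ω₁)`. -/
def e1 : ℂ := W.P W.w1
/-- `e₂ = ℘(ω₂)`. -/
def e2 : ℂ := W.P W.w2
/-- `e₃ = ℘(ω₃)`. -/
def e3 : ℂ := W.P W.w3

/-- The Rofe-Beketov spectrum of the complex Lamé operator
`L = -d²/dx² + m(m+1) ω² ℘(ωx + z₀)` in `L²(ℝ)`: the set of `λ ∈ ℂ` for which
the equation `Lψ = λψ` has a nonzero bounded solution on the whole real line. -/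
def lameSpectrum (m : ℕ) (ω z0 : ℂ) : Set ℂ :=
  {lam | ∃ φ : ℝ → ℂ, φ ≠ 0 ∧ ContDiff ℝ 2 φ ∧
    (∀ x : ℝ, -deriv (deriv φ) x + (m * (m + 1) : ℂ) * ω ^ 2 * W.P (ω * x + z0) * φ x
      = lam * φ x) ∧ ∃ C : ℝ, ∀ x : ℝ, ‖φ x‖ ≤ C}

/-- The function `u(k) = Re[η k - ω ζ(k)]`, where `η = ζ(ω)`. -/
def uFun (ω : ℂ) : ℂ → ℝ := fun k => (W.Z ω * k - ω * W.Z k).re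

/-- The function `v(k) = Im[η k - ω ζ(k)]`, where `η = ζ(ω)`. -/
def vFun (ω : ℂ) : ℂ → ℝ := fun k => (W.Z ω * k - ω * W.Z k).im

end WeierstrassData




open scoped BigOperators

/-- Hermite's solution `ψ⁺ = ∏ⱼ (σ(z+kⱼ)/(σ(z)σ(kⱼ))) · exp(-∑ⱼ ζ(kⱼ) z)` of the
degree-`m` Lamé equation, with auxiliary parameters `k₁, …, k_m`. -/
def hermiteProd (W : WeierstrassData) (m : ℕ) (kv : Fin m → ℂ) : ℂ → ℂ :=
  fun z => (∏ j, W.S (z + kv j) / (W.S z * W.S (kv j)))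
    * Complex.exp (-(∑ j, W.Z (kv j)) * z)


namespace LameAux

open Topology

/-- Mathlib's period pair attached to Weierstrass data. -/
def pp (W : WeierstrassData) : PeriodPair where
  ω₁ := 2 * W.w1
  ω₂ := 2 * W.w3
  indep := by
    rw [LinearIndependent.pair_iff]
    intro s t h
    have h' : (s : ℂ) * W.w1 + (t : ℂ) * W.w3 = 0 := by
      have : (2 : ℂ) * ((s : ℂ) * W.w1 + (t : ℂ) * W.w3) = 0 := by
        simp only [Complex.real_smul] at h
        linear_combination h
      simpa using this
    have ht : t = 0 := by
      by_contra ht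
      apply W.indep (-(s / t))
      have : (t : ℂ) ≠ 0 := by exact_mod_cast ht
      push_cast
      field_simp
      linear_combination h'
    subst ht
    have := W.w1_ne
    simp_all

theorem mem_pp (W : WeierstrassData) (z : ℂ) : z ∈ (pp W).lattice ↔ z ∈ W.lattice := by
  rw [PeriodPair.mem_lattice]
  constructor
  · rintro ⟨m, n, h⟩
    exact ⟨m, n, by rw [← h]; simp [pp]; ring⟩
  · rintro ⟨m, n, h⟩
    exact ⟨m, n, by rw [h]; simp [pp]; ring⟩

theorem coe_pp (W : WeierstrassData) : ((pp W).lattice : Set ℂ) = W.lattice := by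
  ext z; exact mem_pp W z

theorem zero_mem (W : WeierstrassData) : (0 : ℂ) ∈ W.lattice := by
  rw [← mem_pp]; exact Submodule.zero_mem _

theorem add_mem (W : WeierstrassData) {a b : ℂ} (ha : a ∈ W.lattice) (hb : b ∈ W.lattice) :
    a + b ∈ W.lattice := by
  rw [← mem_pp] at *; exact Submodule.add_mem _ ha hb

theorem neg_mem (W : WeierstrassData) {a : ℂ} (ha : a ∈ W.lattice) : -a ∈ W.lattice := by
  rw [← mem_pp] at *; exact Submodule.neg_mem _ ha

theorem neg_mem_iff (W : WeierstrassData) {a : ℂ} : -a ∈ W.lattice ↔ a ∈ W.lattice :=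
  ⟨fun h => by simpa using neg_mem W h, neg_mem W⟩

theorem add_mem_iff (W : WeierstrassData) {a b : ℂ} (hb : b ∈ W.lattice) :
    a + b ∈ W.lattice ↔ a ∈ W.lattice :=
  ⟨fun h => by simpa using add_mem W h (neg_mem W hb), fun h => add_mem W h hb⟩

theorem isClosed_lattice (W : WeierstrassData) : IsClosed W.lattice := by
  rw [← coe_pp]; exact (pp W).isClosed_lattice

theorem isOpen_compl (W : WeierstrassData) : IsOpen (W.lattice)ᶜ := (isClosed_lattice W).isOpen_compl

theorem countable_lattice (W : WeierstrassData) : W.lattice.Countable := by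
  have : W.lattice = Set.range (fun p : ℤ × ℤ => 2 * (p.1 : ℂ) * W.w1 + 2 * (p.2 : ℂ) * W.w3) := by
    ext z
    constructor
    · rintro ⟨m, n, h⟩; exact ⟨(m, n), h.symm⟩
    · rintro ⟨⟨m, n⟩, h⟩; exact ⟨m, n, h.symm⟩
  rw [this]
  exact Set.countable_range _

theorem preconn {s : Set ℂ} (hs : s.Countable) : IsPreconnected sᶜ :=
  (hs.isConnected_compl_of_one_lt_rank (by simp [Complex.rank_real_complex])).isPreconnected

theorem dense_c {s : Set ℂ} (hs : s.Countable) : Dense sᶜ := hs.dense_compl ℂ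

/-- A function with zero derivative off a closed countable set is constant there. -/
theorem const_of_deriv {s : Set ℂ} (hs : s.Countable) (hc : IsClosed s) {f : ℂ → ℂ}
    (hf : ∀ z ∉ s, HasDerivAt f 0 z) {x y : ℂ} (hx : x ∉ s) (hy : y ∉ s) : f x = f y :=
  hc.isOpen_compl.is_const_of_deriv_eq_zero (preconn hs)
    (fun z hz => (hf z hz).differentiableAt.differentiableWithinAt)
    (fun z hz => (hf z hz).deriv) hx hy

/-- punctured neighbourhoods of lattice points avoid the lattice -/
theorem punct (W : WeierstrassData) (a : ℂ) : ∀ᶠ z in 𝓝[≠] a, z ∉ W.lattice := by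
  filter_upwards [self_mem_nhdsWithin, mem_nhdsWithin_of_mem_nhds
    ((pp W).compl_lattice_sdiff_singleton_mem_nhds a)] with z hz hz'
  rw [coe_pp] at hz'
  intro h
  exact hz' ⟨h, hz⟩

/-- Liouville for elliptic functions without poles. -/
theorem liouville (W : WeierstrassData) {f : ℂ → ℂ}
    (hd : ∀ z ∉ W.lattice, DifferentiableAt ℂ f z)
    (hp : ∀ w ∈ W.lattice, ∀ z ∉ W.lattice, f (z + w) = f z) {c : ℂ}
    (hl : Tendsto f (𝓝[≠] 0) (𝓝 c)) : ∀ z ∉ W.lattice, f z = c := by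
  classical
  set g : ℂ → ℂ := fun z => if z ∈ W.lattice then c else f z with hg
  have gper : ∀ w ∈ W.lattice, ∀ z, g (z + w) = g z := by
    intro w hw z
    by_cases hz : z ∈ W.lattice
    · simp [hg, hz, (add_mem_iff W hw).2 hz]
    · simp [hg, hz, mt (add_mem_iff W hw).1 hz, hp w hw z hz]
  have gdiff1 : ∀ z ∉ W.lattice, DifferentiableAt ℂ g z := by
    intro z hz
    refine (hd z hz).congr_of_eventuallyEq ?_
    filter_upwards [(isOpen_compl W).mem_nhds hz] with y hy
    simp only [hg]
    rw [if_neg hy]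
  have g0 : DifferentiableAt ℂ g 0 := by
    refine (analyticAt_of_differentiable_on_punctured_nhds_of_continuousAt ?_ ?_).differentiableAt
    · filter_upwards [punct W 0] with z hz using gdiff1 z hz
    · rw [continuousAt_iff_punctured_nhds]
      have : g 0 = c := by simp [hg, zero_mem W]
      rw [this]
      refine hl.congr' ?_
      filter_upwards [punct W 0] with z hz
      simp [hg, hz]
  have gd : Differentiable ℂ g := by
    intro z
    by_cases hz : z ∈ W.lattice
    · have : g = fun y => g (y + -z) := by
        ext y; rw [gper _ (neg_mem W hz)]
      rw [this]
      have h2 : DifferentiableAt ℂ g (z + -z) := by simpa using g0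
      exact DifferentiableAt.comp (g := g) z h2 (by fun_prop)
    · exact gdiff1 z hz
  intro z hz
  have hb := gd.apply_eq_apply_of_bounded (IsZLattice.isCompact_range_of_periodic (pp W).lattice _
    gd.continuous fun z w hw ↦ gper w ((mem_pp W w).1 hw) z).isBounded z 0
  simpa [hg, hz, zero_mem W] using hb

open PeriodPair in
/-- Identification with Mathlib's `℘`. -/
theorem P_eq (W : WeierstrassData) : ∀ z ∉ W.lattice, W.P z = weierstrassP (pp W) z := by
  have key := liouville W (f := fun z => W.P z - weierstrassP (pp W) z) (c := 0) ?_ ?_ ?_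
  · intro z hz
    exact sub_eq_zero.1 (key z hz)
  · intro z hz
    refine (W.P_diff z hz).sub ?_
    refine ((pp W).differentiableOn_weierstrassP).differentiableAt ?_
    rw [coe_pp]
    exact (isOpen_compl W).mem_nhds hz
  · intro w hw z _
    have h1 := W.P_periodic w hw z
    have h2 := (pp W).weierstrassP_add_coe z ⟨w, (mem_pp W w).2 hw⟩
    simp only at h2
    rw [h1, h2]
  · have h1 := W.P_pole
    have h2 : Tendsto (weierstrassPExcept (pp W) 0) (𝓝[≠] 0) (𝓝 0) := by
      have := ((pp W).analyticAt_weierstrassPExcept 0).continuousAt.tendsto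
      rw [weierstrassPExcept_zero] at this
      exact this.mono_left nhdsWithin_le_nhds
    have h3 := h1.sub h2
    rw [sub_zero] at h3
    refine h3.congr fun z => ?_
    have := (pp W).weierstrassPExcept_def ⟨0, Submodule.zero_mem _⟩ z
    simp only at this
    rw [this]
    simp only [ne_eq, OfNat.ofNat_ne_zero, not_false_eq_true, zero_pow, div_zero, sub_zero]
    ring

theorem P_eventuallyEq (W : WeierstrassData) {z : ℂ} (hz : z ∉ W.lattice) :
    W.P =ᶠ[𝓝 z] PeriodPair.weierstrassP (pp W) := by
  filter_upwards [(isOpen_compl W).mem_nhds hz] with y hy using P_eq W y hy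

theorem P_analytic (W : WeierstrassData) : AnalyticOnNhd ℂ W.P W.latticeᶜ := by
  refine DifferentiableOn.analyticOnNhd (fun z hz => (W.P_diff z hz).differentiableWithinAt)
    (isOpen_compl W)

/-- the derivative of `℘` -/
def P' (W : WeierstrassData) : ℂ → ℂ := deriv W.P

theorem P_hasDeriv (W : WeierstrassData) {z : ℂ} (hz : z ∉ W.lattice) :
    HasDerivAt W.P (P' W z) z := (W.P_diff z hz).hasDerivAt

theorem P_even (W : WeierstrassData) {z : ℂ} (hz : z ∉ W.lattice) : W.P (-z) = W.P z := by
  rw [P_eq W z hz, P_eq W (-z) (by rwa [neg_mem_iff]), PeriodPair.weierstrassP_neg]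

theorem P'_eq (W : WeierstrassData) {z : ℂ} (hz : z ∉ W.lattice) :
    P' W z = PeriodPair.derivWeierstrassP (pp W) z := by
  rw [P', (P_eventuallyEq W hz).deriv_eq, PeriodPair.deriv_weierstrassP]

theorem P'_odd (W : WeierstrassData) {z : ℂ} (hz : z ∉ W.lattice) : P' W (-z) = -P' W z := by
  rw [P'_eq W hz, P'_eq W (by rwa [neg_mem_iff]), PeriodPair.derivWeierstrassP_neg]

/-- `g₂` -/
def g2 (W : WeierstrassData) : ℂ := (pp W).g₂
/-- `g₃` -/
def g3 (W : WeierstrassData) : ℂ := (pp W).g₃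

theorem P'_sq (W : WeierstrassData) {z : ℂ} (hz : z ∉ W.lattice) :
    P' W z ^ 2 = 4 * W.P z ^ 3 - g2 W * W.P z - g3 W := by
  rw [P'_eq W hz, P_eq W z hz]
  exact (pp W).derivWeierstrassP_sq z (by rwa [mem_pp])

theorem P'_analytic (W : WeierstrassData) : AnalyticOnNhd ℂ (P' W) W.latticeᶜ :=
  (P_analytic W).deriv

theorem P_tendsto (W : WeierstrassData) : Tendsto (fun z => z ^ 2 * W.P z) (𝓝[≠] 0) (𝓝 1) := by
  have h1 : Tendsto (fun z : ℂ => z ^ 2) (𝓝[≠] 0) (𝓝 0) := by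
    have : ContinuousAt (fun z : ℂ => z ^ 2) 0 := by fun_prop
    have := this.tendsto.mono_left (nhdsWithin_le_nhds (s := {0}ᶜ))
    simpa using this
  have := (h1.mul W.P_pole).add_const 1
  simp only [zero_mul, zero_add] at this
  refine this.congr' ?_
  filter_upwards [self_mem_nhdsWithin] with z hz
  have : z ≠ 0 := hz
  field_simp
  ring

/-- `℘` takes every value. -/
theorem P_surj (W : WeierstrassData) (r : ℂ) : ∃ k ∉ W.lattice, W.P k = r := by
  by_contra! hcon
  have key := liouville W (f := fun z => (W.P z - r)⁻¹) (c := 0) ?_ ?_ ?_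
  · obtain ⟨z, hz⟩ : ∃ z, z ∉ W.lattice := (punct W 0).exists
    have := key z hz
    simp only [inv_eq_zero, sub_eq_zero] at this
    exact hcon z hz this
  · intro z hz
    exact ((W.P_diff z hz).sub_const r).inv (sub_ne_zero.2 (hcon z hz))
  · intro w hw z _
    simp only [W.P_periodic w hw z]
  · have hid : Tendsto (fun z : ℂ => z ^ 2) (𝓝[≠] 0) (𝓝 0) := by
      have : ContinuousAt (fun z : ℂ => z ^ 2) 0 := by fun_prop
      have := this.tendsto.mono_left (nhdsWithin_le_nhds (s := {0}ᶜ))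
      simpa using this
    have h1 : Tendsto (fun z => z ^ 2 * W.P z - z ^ 2 * r) (𝓝[≠] 0) (𝓝 1) := by
      simpa using (P_tendsto W).sub (hid.mul_const r)
    have h2 := hid.mul (h1.inv₀ one_ne_zero)
    simp only [zero_mul] at h2
    refine h2.congr' ?_
    filter_upwards [self_mem_nhdsWithin, punct W 0] with z hz hz'
    have h0 : z ≠ 0 := hz
    rw [← mul_sub, mul_inv, ← mul_assoc, mul_inv_cancel₀ (pow_ne_zero 2 h0), one_mul]

theorem P'_hasDeriv (W : WeierstrassData) {z : ℂ} (hz : z ∉ W.lattice) :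
    HasDerivAt (P' W) (6 * W.P z ^ 2 - g2 W / 2) z := by
  have hd : ∀ z ∉ W.lattice, HasDerivAt (P' W) (deriv (P' W) z) z := fun z hz =>
    (P'_analytic W z hz).differentiableAt.hasDerivAt
  have hmul : ∀ z ∈ W.latticeᶜ, P' W z * (deriv (P' W) z - (6 * W.P z ^ 2 - g2 W / 2)) = 0 := by
    intro z hz
    have h1 : HasDerivAt (fun z => P' W z ^ 2) _ z := (hd z hz).pow 2
    have h2 : HasDerivAt (fun z => 4 * W.P z ^ 3 - g2 W * W.P z - g3 W) _ z :=
      ((((P_hasDeriv W hz).pow 3).const_mul 4).sub ((P_hasDeriv W hz).const_mul (g2 W))).sub_const _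
    have heq : (fun z => P' W z ^ 2) =ᶠ[𝓝 z] (fun z => 4 * W.P z ^ 3 - g2 W * W.P z - g3 W) := by
      filter_upwards [(isOpen_compl W).mem_nhds hz] with y hy using P'_sq W hy
    have := h1.unique (h2.congr_of_eventuallyEq heq)
    norm_num at this
    linear_combination this / 2
  have han : AnalyticOnNhd ℂ (fun z => deriv (P' W) z - (6 * W.P z ^ 2 - g2 W / 2)) W.latticeᶜ := by
    intro z hz
    have h1 := (P'_analytic W).deriv z hz
    have h2 := P_analytic W z hz
    fun_prop
  rcases (P'_analytic W).eq_zero_or_eq_zero_of_mul_eq_zero han hmul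
    (preconn (countable_lattice W)) with h | h
  · exfalso
    obtain ⟨k, hk, hk'⟩ := P_surj W 0
    obtain ⟨l, hl, hl'⟩ := P_surj W 1
    have := const_of_deriv (countable_lattice W) (isClosed_lattice W) (f := W.P)
      (fun z hz => by have := P_hasDeriv W hz; rwa [h z hz] at this) hk hl
    rw [hk', hl'] at this
    exact zero_ne_one this
  · have := hd z hz
    rwa [sub_eq_zero.1 (h z hz)] at this

theorem Z_hasDeriv (W : WeierstrassData) {z : ℂ} (hz : z ∉ W.lattice) :
    HasDerivAt W.Z (-W.P z) z := by
  rw [← W.Z_deriv z hz]; exact (W.Z_diff z hz).hasDerivAt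

theorem S_hasDeriv (W : WeierstrassData) {z : ℂ} (hz : z ∉ W.lattice) :
    HasDerivAt W.S (W.Z z * W.S z) z := by
  rw [← W.S_deriv z hz]; exact (W.S_diff z).hasDerivAt

theorem Z_quasi (W : WeierstrassData) {w : ℂ} (hw : w ∈ W.lattice) :
    ∃ η : ℂ, ∀ z ∉ W.lattice, W.Z (z + w) = W.Z z + η := by
  obtain ⟨z₁, hz₁⟩ : ∃ z, z ∉ W.lattice := (punct W 0).exists
  refine ⟨W.Z (z₁ + w) - W.Z z₁, fun z hz => ?_⟩
  have := const_of_deriv (countable_lattice W) (isClosed_lattice W)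
    (f := fun z => W.Z (z + w) - W.Z z) ?_ hz hz₁
  · linear_combination this
  · intro z hz
    have h1 : HasDerivAt (fun z => W.Z (z + w)) (-W.P (z + w)) z :=
      (Z_hasDeriv W (mt (add_mem_iff W hw).1 hz)).comp_add_const z w
    have := h1.sub (Z_hasDeriv W hz)
    rw [W.P_periodic w hw] at this
    simpa using! this

theorem S_quasi_of (W : WeierstrassData) {w : ℂ} (hw : w ∈ W.lattice) {η : ℂ}
    (hη : ∀ z ∉ W.lattice, W.Z (z + w) = W.Z z + η) :
    ∃ A : ℂ, A ≠ 0 ∧ ∀ z, W.S (z + w) = A * exp (η * z) * W.S z := by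
  obtain ⟨z₁, hz₁⟩ : ∃ z, z ∉ W.lattice := (punct W 0).exists
  set F : ℂ → ℂ := fun z => W.S (z + w) / W.S z * exp (-(η * z)) with hF
  have hconst : ∀ z ∉ W.lattice, F z = F z₁ := by
    intro z hz
    refine const_of_deriv (countable_lattice W) (isClosed_lattice W) ?_ hz hz₁
    intro z hz
    have hz' := mt (add_mem_iff W hw).1 hz
    have h1 : HasDerivAt (fun z => W.S (z + w)) (W.Z (z + w) * W.S (z + w)) z :=
      (S_hasDeriv W hz').comp_add_const z w
    have h2 := S_hasDeriv W hz
    have h3 : HasDerivAt (fun z => exp (-(η * z))) _ z :=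
      (((hasDerivAt_id z).const_mul η).neg).cexp
    have hS := W.S_ne z hz
    convert! (h1.div h2 hS).mul h3 using 1
    rw [hη z hz]
    simp only [id, Pi.neg_apply, Pi.div_apply]
    field_simp
    ring
  refine ⟨F z₁, ?_, ?_⟩
  · simp only [hF]
    exact mul_ne_zero (div_ne_zero (W.S_ne _ (mt (add_mem_iff W hw).1 hz₁)) (W.S_ne _ hz₁))
      (exp_ne_zero _)
  · have hc := W.S_diff.continuous
    have : (fun z => W.S (z + w)) = fun z => F z₁ * exp (η * z) * W.S z := by
      refine Continuous.ext_on (dense_c (countable_lattice W)) (by fun_prop) (by fun_prop) ?_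
      intro z hz
      have hS := W.S_ne z hz
      simp only
      rw [← hconst z hz]
      simp only [hF]
      rw [exp_neg]
      have := exp_ne_zero (η * z)
      field_simp
    exact fun z => congrFun this z

theorem S_zero (W : WeierstrassData) : W.S 0 = 0 := by
  have h1 : Tendsto (fun z : ℂ => z) (𝓝[≠] 0) (𝓝 0) := nhdsWithin_le_nhds
  have h2 := W.S_norm.mul h1
  rw [mul_zero] at h2
  have h3 : Tendsto W.S (𝓝[≠] 0) (𝓝 (W.S 0)) :=
    W.S_diff.continuous.continuousAt.tendsto.mono_left nhdsWithin_le_nhds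
  refine tendsto_nhds_unique h3 (h2.congr' ?_)
  filter_upwards [self_mem_nhdsWithin] with z hz
  have : z ≠ 0 := hz
  field_simp

theorem S_lattice (W : WeierstrassData) {z : ℂ} (hz : z ∈ W.lattice) : W.S z = 0 := by
  obtain ⟨η, hη⟩ := Z_quasi W hz
  obtain ⟨A, -, hA⟩ := S_quasi_of W hz hη
  have := hA 0
  rw [zero_add, S_zero, mul_zero] at this
  exact this

theorem S_odd (W : WeierstrassData) (z : ℂ) : W.S (-z) = -W.S z := by
  set F : ℂ → ℂ := fun z => W.S (-z) / W.S z with hF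
  by_cases hz : z ∈ W.lattice
  · rw [S_lattice W hz, S_lattice W (neg_mem W hz), neg_zero]
  have hconst : ∀ y ∉ W.lattice, F y = F z := by
    intro y hy
    refine const_of_deriv (countable_lattice W) (isClosed_lattice W) ?_ hy hz
    intro z hz
    have hz' : -z ∉ W.lattice := by rwa [neg_mem_iff]
    have h1 : HasDerivAt (fun z => W.S (-z)) (W.Z (-z) * W.S (-z) * (-1)) z :=
      (S_hasDeriv W hz').comp z (hasDerivAt_neg z)
    convert! h1.div (S_hasDeriv W hz) (W.S_ne z hz) using 1
    rw [W.Z_odd]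
    field_simp
    ring
  have hS := W.S_ne z hz
  have hlim : Tendsto F (𝓝[≠] 0) (𝓝 (-1)) := by
    have hn : Tendsto (fun z : ℂ => -z) (𝓝[≠] 0) (𝓝[≠] 0) := by
      refine tendsto_nhdsWithin_iff.2 ⟨?_, ?_⟩
      · have : ContinuousAt (fun z : ℂ => -z) 0 := by fun_prop
        have := this.tendsto.mono_left (nhdsWithin_le_nhds (s := {0}ᶜ))
        simpa using this
      · filter_upwards [self_mem_nhdsWithin] with z hz
        simpa using hz
    have h1 := (W.S_norm.comp hn).neg.div W.S_norm one_ne_zero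
    rw [div_one] at h1
    refine h1.congr' ?_
    filter_upwards [self_mem_nhdsWithin, punct W 0] with y hy hy'
    have : y ≠ 0 := hy
    have := W.S_ne y hy'
    simp only [Function.comp, hF, Pi.div_apply]
    field_simp
  have h2 : Tendsto F (𝓝[≠] 0) (𝓝 (F z)) := by
    refine tendsto_const_nhds.congr' ?_
    filter_upwards [punct W 0] with y hy using (hconst y hy).symm
  have := tendsto_nhds_unique h2 hlim
  simp only [hF] at this
  rw [div_eq_iff hS] at this
  rw [this]; ring

/-- even analytic function: the second difference quotient has a limit -/
theorem even_lim {g : ℂ → ℂ} (hg : AnalyticAt ℂ g 0) (he : ∀ z, g (-z) = g z) :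
    ∃ c, Tendsto (fun z => (g z - g 0) / z ^ 2) (𝓝[≠] 0) (𝓝 c) := by
  have hd : deriv g 0 = 0 := by
    have h1 : HasDerivAt g (deriv g 0) (-0) := by
      rw [neg_zero]; exact hg.differentiableAt.hasDerivAt
    have h2 := h1.comp (0 : ℂ) (hasDerivAt_neg (0 : ℂ))
    have h3 : g ∘ Neg.neg = g := funext he
    rw [h3] at h2
    have := h2.deriv
    have h4 : deriv g 0 * 2 = 0 := by linear_combination this
    simpa using h4
  obtain ⟨s, hs, hs'⟩ := hg.exists_mem_nhds_analyticOnNhd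
  have h1 : DifferentiableOn ℂ (dslope g 0) s :=
    (Complex.differentiableOn_dslope hs).2 hs'.differentiableOn
  have h2 : DifferentiableOn ℂ (dslope (dslope g 0) 0) s :=
    (Complex.differentiableOn_dslope hs).2 h1
  have h3 := (h2.differentiableAt hs).continuousAt.tendsto.mono_left
    (nhdsWithin_le_nhds (s := {0}ᶜ))
  refine ⟨_, h3.congr' ?_⟩
  filter_upwards [self_mem_nhdsWithin] with z hz
  have hz0 : z ≠ 0 := hz
  rw [dslope_of_ne _ hz0, slope_def_field, dslope_of_ne _ hz0, dslope_same, hd, slope_def_field]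
  field_simp
  ring

/-- `σ(z+k)σ(z-k)/σ(z)² = -σ(k)²(℘(z)-℘(k))` -/
theorem sigma_formula (W : WeierstrassData) {k z : ℂ} (hk : k ∉ W.lattice) (hz : z ∉ W.lattice) :
    W.S (z + k) * W.S (z - k) / W.S z ^ 2 = -(W.S k ^ 2) * (W.P z - W.P k) := by
  have hSan : ∀ a, AnalyticAt ℂ W.S a := fun a => W.S_diff.analyticAt a
  set g : ℂ → ℂ := fun z => W.S (z + k) * W.S (z - k) / (dslope W.S 0 z) ^ 2 with hg
  have hS'0 : deriv W.S 0 = 1 := by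
    have h1 := (W.S_diff 0).hasDerivAt
    rw [hasDerivAt_iff_tendsto_slope] at h1
    refine tendsto_nhds_unique h1 (W.S_norm.congr fun z => ?_)
    rw [slope_def_field, S_zero, sub_zero, sub_zero]
  have hev : ∀ z, g (-z) = g z := by
    intro z
    have h1 : W.S (-z + k) = -W.S (z - k) := by rw [← S_odd]; congr 1; ring
    have h2 : W.S (-z - k) = -W.S (z + k) := by rw [← S_odd]; congr 1; ring
    have h3 : dslope W.S 0 (-z) = dslope W.S 0 z := by
      by_cases h : z = 0
      · simp [h]
      · rw [dslope_of_ne _ h, dslope_of_ne _ (neg_ne_zero.2 h), slope_def_field, slope_def_field,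
          S_odd, S_zero, sub_zero, sub_zero, sub_zero, sub_zero, neg_div_neg_eq]
    simp only [hg, h1, h2, h3]
    ring
  have hds : Differentiable ℂ (dslope W.S 0) := by
    rw [← differentiableOn_univ] 
    exact (Complex.differentiableOn_dslope univ_mem).2 W.S_diff.differentiableOn
  have hga : AnalyticAt ℂ g 0 := by
    have h1 := hds.analyticAt 0
    have h2 : AnalyticAt ℂ (fun z => W.S (z + k)) 0 := 
      (W.S_diff.comp (by fun_prop : Differentiable ℂ fun z : ℂ => z + k)).analyticAt 0
    have h3 : AnalyticAt ℂ (fun z => W.S (z - k)) 0 := 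
      (W.S_diff.comp (by fun_prop : Differentiable ℂ fun z : ℂ => z - k)).analyticAt 0
    refine (h2.mul h3).div (h1.pow 2) ?_
    simp [hS'0]
  have hg0 : g 0 = -(W.S k ^ 2) := by
    simp only [hg, dslope_same, hS'0, zero_add, zero_sub, S_odd]
    ring
  obtain ⟨c, hc⟩ := even_lim hga hev
  have key := liouville W
    (f := fun z => W.S (z + k) * W.S (z - k) / W.S z ^ 2 - g 0 * W.P z) (c := c) ?_ ?_ ?_
  · have h1 := key z hz
    have h2 := key k hk
    simp only [sub_self, S_zero, mul_zero, zero_div, zero_sub] at h2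
    rw [hg0] at h1 h2
    linear_combination h1 - h2
  · intro z hz
    have h1 := W.P_diff z hz
    have h2 : DifferentiableAt ℂ (fun z => W.S (z + k)) z := 
      (W.S_diff.comp (by fun_prop : Differentiable ℂ fun z : ℂ => z + k)) z
    have h3 : DifferentiableAt ℂ (fun z => W.S (z - k)) z := 
      (W.S_diff.comp (by fun_prop : Differentiable ℂ fun z : ℂ => z - k)) z
    exact ((h2.mul h3).div ((W.S_diff z).pow 2) (pow_ne_zero 2 (W.S_ne z hz))).sub
      (h1.const_mul _)
  · intro w hw z hz
    obtain ⟨η, hη⟩ := Z_quasi W hw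
    obtain ⟨A, hA0, hA⟩ := S_quasi_of W hw hη
    have h1 : z + w + k = (z + k) + w := by ring
    have h2 : z + w - k = (z - k) + w := by ring
    rw [h1, h2, hA, hA, hA, W.P_periodic w hw]
    have hS := W.S_ne z hz
    have h3 : exp (η * (z + k)) * exp (η * (z - k)) = exp (η * z) ^ 2 := by
      rw [← exp_add, ← exp_nat_mul]; congr 1; push_cast; ring
    have he := exp_ne_zero (η * z)
    have h4 : A * exp (η * (z + k)) * W.S (z + k) * (A * exp (η * (z - k)) * W.S (z - k))
      = (A * exp (η * z)) ^ 2 * (W.S (z + k) * W.S (z - k)) := by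
      linear_combination A ^ 2 * W.S (z + k) * W.S (z - k) * h3
    rw [h4, mul_pow (A * exp (η * z)), mul_div_mul_left]
    exact pow_ne_zero 2 (mul_ne_zero hA0 he)
  · have h1 := hc.sub (W.P_pole.const_mul (g 0))
    rw [mul_zero, sub_zero] at h1
    refine h1.congr' ?_
    filter_upwards [self_mem_nhdsWithin, punct W 0] with y hy hy'
    have hy0 : y ≠ 0 := hy
    have h2 : g y = W.S (y + k) * W.S (y - k) / W.S y ^ 2 * y ^ 2 := by
      simp only [hg, dslope_of_ne _ hy0, slope_def_field, S_zero, sub_zero]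
      have := W.S_ne y hy'
      field_simp
    rw [h2]
    field_simp
    ring

theorem P_eq_iff (W : WeierstrassData) {k z : ℂ} (hk : k ∉ W.lattice) (hz : z ∉ W.lattice)
    (h : W.P z = W.P k) : z + k ∈ W.lattice ∨ z - k ∈ W.lattice := by
  have := sigma_formula W hk hz
  rw [h, sub_self, mul_zero, div_eq_zero_iff] at this
  rcases this with h | h
  · rcases mul_eq_zero.1 h with h | h
    · left; by_contra h'; exact W.S_ne _ h' h
    · right; by_contra h'; exact W.S_ne _ h' h
  · exact absurd h (pow_ne_zero 2 (W.S_ne z hz))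

/-- half of the addition theorem -/
theorem zeta_half (W : WeierstrassData) {k z : ℂ} (hk : k ∉ W.lattice) (hz : z ∉ W.lattice)
    (h1 : z + k ∉ W.lattice) (h2 : z - k ∉ W.lattice) :
    W.Z (z + k) + W.Z (z - k) - 2 * W.Z z = P' W z / (W.P z - W.P k) := by
  have d1 : HasDerivAt (fun z => W.S (z + k)) _ z := (S_hasDeriv W h1).comp_add_const z k
  have d2 : HasDerivAt (fun z => W.S (z - k)) _ z := (S_hasDeriv W h2).comp_sub_const z k
  have s0 := W.S_ne z hz
  have s1 := W.S_ne _ h1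
  have s2 := W.S_ne _ h2
  have sk := W.S_ne _ hk
  have e1 : HasDerivAt (fun z => W.S (z + k) * W.S (z - k) / W.S z ^ 2) _ z :=
    (d1.mul d2).div ((S_hasDeriv W hz).pow 2) (pow_ne_zero 2 s0)
  have e2 : HasDerivAt (fun z => -(W.S k ^ 2) * (W.P z - W.P k)) _ z :=
    ((P_hasDeriv W hz).sub_const (W.P k)).const_mul (-(W.S k ^ 2))
  have heq : (fun z => W.S (z + k) * W.S (z - k) / W.S z ^ 2) =ᶠ[𝓝 z]
      (fun z => -(W.S k ^ 2) * (W.P z - W.P k)) := by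
    filter_upwards [(isOpen_compl W).mem_nhds hz] with y hy using sigma_formula W hk hy
  have h := e1.unique (e2.congr_of_eventuallyEq heq)
  have hf := sigma_formula W hk hz
  have hne : W.P z - W.P k ≠ 0 := by
    intro h0
    rw [h0, mul_zero] at hf
    exact div_ne_zero (mul_ne_zero s1 s2) (pow_ne_zero 2 s0) hf
  rw [eq_div_iff hne]
  have hk2 : -(W.S k ^ 2) ≠ 0 := neg_ne_zero.2 (pow_ne_zero 2 sk)
  apply mul_left_cancel₀ hk2
  rw [← h]
  have : -W.S k ^ 2 * ((W.Z (z + k) + W.Z (z - k) - 2 * W.Z z) * (W.P z - W.P k))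
    = (W.Z (z + k) + W.Z (z - k) - 2 * W.Z z) * (W.S (z + k) * W.S (z - k) / W.S z ^ 2) := by
    rw [hf]; ring
  rw [this]
  simp only [Pi.mul_apply]
  field_simp
  push_cast
  ring

/-- addition theorem for `ζ` -/
theorem zeta_add (W : WeierstrassData) {k z : ℂ} (hk : k ∉ W.lattice) (hz : z ∉ W.lattice)
    (h1 : z + k ∉ W.lattice) (h2 : z - k ∉ W.lattice) :
    W.Z (z + k) - W.Z z - W.Z k = (P' W z - P' W k) / (2 * (W.P z - W.P k)) := by
  have a := zeta_half W hk hz h1 h2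
  have h2' : k - z ∉ W.lattice := by
    rw [← neg_mem_iff]; simpa using h2
  have b := zeta_half W hz hk (by rwa [add_comm]) h2'
  have c : W.Z (k - z) = -W.Z (z - k) := by rw [← W.Z_odd]; congr 1; ring
  rw [c, add_comm k z] at b
  have d : P' W k / (W.P k - W.P z) = -(P' W k / (W.P z - W.P k)) := by
    rw [← div_neg]; congr 1; ring
  rw [d] at b
  rw [mul_comm 2, ← div_div, sub_div]
  linear_combination (a + b) / 2

/-- the cubic `4u³ - g₂u - g₃` has simple roots -/
theorem simple_roots (W : WeierstrassData) {r : ℂ} (h0 : 4 * r ^ 3 - g2 W * r - g3 W = 0) :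
    12 * r ^ 2 - g2 W ≠ 0 := by
  intro h1
  obtain ⟨k, hk, hkr⟩ := P_surj W r
  have hfa : AnalyticAt ℂ (fun z => W.P z - r) k := (P_analytic W k hk).sub analyticAt_const
  have hnz : ¬ ∀ᶠ z in 𝓝 k, W.P z - r = 0 := by
    intro hev
    have hcount : (((fun z => z + k) ⁻¹' W.lattice) ∪ ((fun z => z - k) ⁻¹' W.lattice) ∪
        W.lattice).Countable := by
      refine Set.Countable.union (Set.Countable.union ?_ ?_) (countable_lattice W)
      · exact (countable_lattice W).preimage (add_left_injective k)
      · exact (countable_lattice W).preimage (sub_left_injective (b := k))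
    obtain ⟨z, hz1, hz2⟩ := (dense_c hcount).inter_nhds_nonempty hev
    simp only [mem_compl_iff, mem_union, mem_preimage, not_or] at hz1
    rcases P_eq_iff W hk hz1.2 ((sub_eq_zero.1 hz2).trans hkr.symm) with h | h
    · exact hz1.1.1 h
    · exact hz1.1.2 h
  obtain ⟨n, h, ha, hne, hev⟩ := hfa.exists_eventuallyEq_pow_smul_nonzero_iff.2 hnz
  have hn : n ≠ 0 := by
    rintro rfl
    have := hev.self_of_nhds
    simp [hkr] at this
    exact hne this.symm
  obtain ⟨n, rfl⟩ := Nat.exists_eq_succ_of_ne_zero hn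
  have hmain : ∀ᶠ z in 𝓝[≠] k, (((n : ℂ) + 1) * h z + (z - k) * deriv h z) ^ 2
      = (z - k) ^ 2 * h z ^ 2 * (4 * (W.P z - r) + 12 * r) := by
    filter_upwards [self_mem_nhdsWithin, mem_nhdsWithin_of_mem_nhds hev.eventually_nhds,
      mem_nhdsWithin_of_mem_nhds ha.eventually_analyticAt,
      mem_nhdsWithin_of_mem_nhds ((isOpen_compl W).mem_nhds hk)] with z hz hz1 hz2 hz3
    have hzk : z - k ≠ 0 := sub_ne_zero.2 hz
    have d1 : HasDerivAt (fun z => W.P z - r) (P' W z) z := (P_hasDeriv W hz3).sub_const r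
    have d2 : HasDerivAt (fun z => (z - k) ^ (n + 1) * h z) _ z :=
      (((hasDerivAt_id z).sub_const k).pow (n + 1)).mul hz2.differentiableAt.hasDerivAt
    have heq : (fun z => W.P z - r) =ᶠ[𝓝 z] (fun z => (z - k) ^ (n + 1) * h z) := by
      filter_upwards [hz1] with y hy
      simpa using hy
    have e := d1.unique (d2.congr_of_eventuallyEq heq)
    have e2 := heq.self_of_nhds
    have e3 := P'_sq W hz3
    have e4 : P' W z ^ 2 = (W.P z - r) ^ 2 * (4 * (W.P z - r) + 12 * r) := by
      rw [e3]; linear_combination h0 + (W.P z - r) * h1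
    have e5 : P' W z = (z - k) ^ n * (((n : ℂ) + 1) * h z + (z - k) * deriv h z) := by
      rw [e]; simp; ring
    simp only at e2
    have e6 : ((z - k) ^ n) ^ 2 * (((n : ℂ) + 1) * h z + (z - k) * deriv h z) ^ 2
      = ((z - k) ^ n) ^ 2 * ((z - k) ^ 2 * h z ^ 2 * (4 * (W.P z - r) + 12 * r)) := by
      calc _ = P' W z ^ 2 := by rw [e5]; ring
        _ = ((z - k) ^ (n + 1) * h z) ^ 2 * (4 * (W.P z - r) + 12 * r) := by rw [e4, ← e2]
        _ = _ := by ring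
    exact mul_left_cancel₀ (pow_ne_zero 2 (pow_ne_zero n hzk)) e6
  have c1 : ContinuousAt (fun z => (((n : ℂ) + 1) * h z + (z - k) * deriv h z) ^ 2) k := by
    have := ha.continuousAt
    have := ha.deriv.continuousAt
    fun_prop
  have c2 : ContinuousAt (fun z => (z - k) ^ 2 * h z ^ 2 * (4 * (W.P z - r) + 12 * r)) k := by
    have := ha.continuousAt
    have := (P_analytic W k hk).continuousAt
    fun_prop
  have := tendsto_nhds_unique ((c1.tendsto.mono_left nhdsWithin_le_nhds).congr' hmain)
    (c2.tendsto.mono_left nhdsWithin_le_nhds)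
  have hn1 : (n : ℂ) + 1 ≠ 0 := by exact_mod_cast Nat.succ_ne_zero n
  simp at this
  rcases this with h | h
  · exact hn1 h
  · exact hne h

section Poly

open Polynomial

/-- the cubic -/
def cub (a b : ℂ) : ℂ[X] := C 4 * X ^ 3 - C a * X - C b

/-- the third order operator satisfied by products of solutions, in the variable `u = ℘` -/
def Top (a b M μ : ℂ) (p : ℂ[X]) : ℂ[X] :=
  cub a b * derivative (derivative (derivative p))
    + (C 18 * X ^ 2 - C (3 / 2 * a)) * derivative (derivative p)
    + (C (12 - 4 * M) * X + C (4 * μ)) * derivative p - C (2 * M) * p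

/-- first integral -/
def Dop (a b M μ : ℂ) (p : ℂ[X]) : ℂ[X] :=
  cub a b * derivative p ^ 2
    - C 2 * p * (cub a b * derivative (derivative p) + (C 6 * X ^ 2 - C (a / 2)) * derivative p)
    + C 4 * (C M * X - C μ) * p ^ 2

theorem Dop_deriv (a b M μ : ℂ) (p : ℂ[X]) :
    derivative (Dop a b M μ p) = - (C 2 * p * Top a b M μ p) := by
  have h3 : (C (3 / 2 * a) : ℂ[X]) = 3 * C (a / 2) := by
    rw [← C_ofNat, ← C_mul]; congr 1; ring
  have ha : (C a : ℂ[X]) = 2 * C (a / 2) := by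
    rw [← C_ofNat, ← C_mul]; congr 1; ring
  simp only [Dop, Top, cub, derivative_add, derivative_sub, derivative_mul, derivative_pow,
    derivative_C, derivative_X, C_ofNat, C_sub, C_mul, h3, ha]
  simp only [derivative_ofNat, Nat.cast_ofNat]
  have h3 : (C 3 * C (a / 2) : ℂ[X]) = 3 * C (a / 2) := by rw [C_ofNat]
  ring_nf
  try simp only [C_ofNat]
  try ring

theorem Top_add (a b M μ : ℂ) (p q : ℂ[X]) : Top a b M μ (p + q) = Top a b M μ p + Top a b M μ q := by
  simp only [Top, derivative_add]; ring

theorem Top_sub (a b M μ : ℂ) (p q : ℂ[X]) : Top a b M μ (p - q) = Top a b M μ p - Top a b M μ q := by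
  simp only [Top, derivative_sub]; ring

theorem Top_C_mul (a b M μ c : ℂ) (p : ℂ[X]) : Top a b M μ (C c * p) = C c * Top a b M μ p := by
  simp only [Top, derivative_C_mul]; ring

end Poly

section Poly2

open Polynomial

theorem Top_X_pow (a b M μ : ℂ) (n : ℕ) :
    (Top a b M μ (X ^ n) - C (2 * (2 * n + 1) * (n * (n + 1) - M)) * X ^ n).degree
      < (n : WithBot ℕ) := by
  match n with
  | 0 =>
    have : Top a b M μ (X ^ 0) - C (2 * (2 * (0 : ℕ) + 1) * ((0 : ℕ) * ((0 : ℕ) + 1) - M)) * X ^ 0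
        = 0 := by
      refine Polynomial.funext fun x => ?_
      simp [Top, cub]
    rw [this]; simp
  | 1 =>
    have : Top a b M μ (X ^ 1) - C (2 * (2 * (1 : ℕ) + 1) * ((1 : ℕ) * ((1 : ℕ) + 1) - M)) * X ^ 1
        = C (4 * μ) := by
      refine Polynomial.funext fun x => ?_
      simp [Top, cub]; ring
    rw [this]; exact lt_of_le_of_lt degree_C_le (by norm_num)
  | 2 =>
    have : Top a b M μ (X ^ 2) - C (2 * (2 * (2 : ℕ) + 1) * ((2 : ℕ) * ((2 : ℕ) + 1) - M)) * X ^ 2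
        = C (8 * μ) * X + C (- 3 * a) := by
      refine Polynomial.funext fun x => ?_
      simp [Top, cub]; ring
    rw [this]; exact lt_of_le_of_lt degree_linear_le (by norm_num)
  | k + 3 =>
    have : Top a b M μ (X ^ (k + 3))
        - C (2 * (2 * (k + 3 : ℕ) + 1) * ((k + 3 : ℕ) * ((k + 3 : ℕ) + 1) - M)) * X ^ (k + 3)
        = X ^ k * (C (4 * μ * (k + 3)) * X ^ 2
          + C (-(a * (k + 3) * (k + 2) * (k + 1)) - 3 / 2 * a * (k + 3) * (k + 2)) * X
          + C (- b * (k + 3) * (k + 2) * (k + 1))) := by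
      refine Polynomial.funext fun x => ?_
      simp [Top, cub]; ring
    rw [this]
    refine lt_of_le_of_lt (degree_mul_le _ _) ?_
    rw [degree_X_pow]
    refine lt_of_le_of_lt (add_le_add_right degree_quadratic_le _) ?_
    exact_mod_cast Nat.lt_succ_self (k + 2)

theorem Top_surj (a b μ : ℂ) (m : ℕ) : ∀ n ≤ m, ∀ r : ℂ[X], r.degree < (n : WithBot ℕ) →
    ∃ q : ℂ[X], q.degree < (n : WithBot ℕ) ∧ Top a b (m * (m + 1)) μ q = r := by
  intro n
  induction n with
  | zero =>
    intro _ r hr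
    have : r = 0 := by
      rw [← degree_eq_bot]
      by_contra h
      exact absurd hr (not_lt.2 (by simpa using (zero_le_degree_iff.2 (by simpa using h))))
    exact ⟨0, by simp, by simp [this, Top]⟩
  | succ n ih =>
    intro hn r hr
    set α : ℂ := 2 * (2 * n + 1) * (n * (n + 1) - m * (m + 1)) with hα
    have hα0 : α ≠ 0 := by
      have h1 : (2 * (2 * (n : ℤ) + 1) * (n * (n + 1) - m * (m + 1)) : ℤ) ≠ 0 := by
        have : (n : ℤ) * (n + 1) - m * (m + 1) < 0 := by
          have : (n : ℤ) + 1 ≤ m := by exact_mod_cast hn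
          nlinarith
        have h3 : 0 < 2 * (2 * (n : ℤ) + 1) := by positivity
        exact (mul_neg_of_pos_of_neg h3 this).ne
      rw [hα]; exact_mod_cast h1
    set c := r.coeff n / α
    have hcoef : c * α = r.coeff n := div_mul_cancel₀ _ hα0
    have hdeg := Top_X_pow a b (m * (m + 1)) μ n
    have key : (r - Top a b (m * (m + 1)) μ (C c * X ^ n)).degree < (n : WithBot ℕ) := by
      have e : r - Top a b (m * (m + 1)) μ (C c * X ^ n) = (r - C (r.coeff n) * X ^ n)
          - C c * (Top a b (m * (m + 1)) μ (X ^ n) - C α * X ^ n) := by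
        rw [Top_C_mul, ← hcoef, C_mul]; ring
      rw [e]
      refine lt_of_le_of_lt (degree_sub_le _ _) (max_lt ?_ ?_)
      · rw [degree_lt_iff_coeff_zero]
        intro k hk
        rcases hk.eq_or_lt with h | h
        · subst h; simp
        · have : r.coeff k = 0 := coeff_eq_zero_of_degree_lt (lt_of_lt_of_le hr (by exact_mod_cast h))
          simp [this, coeff_X_pow, h.ne']
      · refine lt_of_le_of_lt (degree_mul_le _ _) ?_
        refine lt_of_le_of_lt (add_le_add_left degree_C_le _) ?_
        rw [zero_add]; exact hdeg
    obtain ⟨q, hq, hqe⟩ := ih (by omega) _ key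
    refine ⟨q + C c * X ^ n, ?_, ?_⟩
    · refine lt_of_le_of_lt (degree_add_le _ _) (max_lt ?_ ?_)
      · exact hq.trans (by exact_mod_cast Nat.lt_succ_self n)
      · exact lt_of_le_of_lt (degree_C_mul_X_pow_le _ _) (by exact_mod_cast Nat.lt_succ_self n)
    · rw [Top_add, hqe]; ring

theorem exists_poly (a b μ : ℂ) (m : ℕ) : ∃ (p : ℂ[X]) (c : ℂ), p.Monic ∧ p.natDegree = m ∧
    Dop a b (m * (m + 1)) μ p = C (c ^ 2) := by
  have h := Top_X_pow a b (m * (m + 1)) μ m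
  rw [sub_self, mul_zero, C_0, zero_mul, sub_zero] at h
  obtain ⟨q, hq, hqe⟩ := Top_surj a b μ m m le_rfl _ h
  have hmon : (X ^ m - q).Monic := monic_X_pow_sub hq
  have hT : Top a b (m * (m + 1)) μ (X ^ m - q) = 0 := by rw [Top_sub, hqe, sub_self]
  have hD := Dop_deriv a b (m * (m + 1)) μ (X ^ m - q)
  rw [hT, mul_zero, neg_zero] at hD
  have hC := eq_C_of_derivative_eq_zero hD
  obtain ⟨c, hc⟩ := IsAlgClosed.exists_pow_nat_eq ((Dop a b (m * (m + 1)) μ (X ^ m - q)).coeff 0)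
    (n := 2) (by norm_num)
  refine ⟨X ^ m - q, c, hmon, ?_, ?_⟩
  · have : (X ^ m - q).degree = (m : WithBot ℕ) := by
      rw [degree_sub_eq_left_of_degree_lt] <;> rw [degree_X_pow]
      exact hq
    exact natDegree_eq_of_degree_eq_some this
  · rw [hc]; exact hC

end Poly2

section Poly3

open Polynomial

theorem mult_zero (a b M μ r : ℂ) (k : ℕ) (p q : ℂ[X]) (hp : p = (X - C r) ^ (k + 1) * q)
    (hq : q.eval r ≠ 0) (hD : Dop a b M μ p = 0)
    (hs : 4 * r ^ 3 - a * r - b = 0 → 12 * r ^ 2 - a ≠ 0) :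
    (4 * r ^ 3 - a * r - b ≠ 0 ∧ k = 1) ∨ (4 * r ^ 3 - a * r - b = 0 ∧ k = 0) := by
  set L : ℂ[X] := X - C r with hL
  have hL0 : L ≠ 0 := X_sub_C_ne_zero r
  have dL : derivative L = 1 := by simp [hL]
  set A : ℂ[X] := ((k : ℂ[X]) + 1) * q + L * derivative q with hA
  set B : ℂ[X] := (k : ℂ[X]) * A + L * derivative A with hB
  have h1 : derivative p = L ^ k * A := by
    rw [hp, derivative_mul, derivative_pow, dL, hA]; simp; ring
  have h2 : L * derivative (derivative p) = L ^ k * B := by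
    rw [h1, derivative_mul, derivative_pow, dL, hB]
    rcases k with _ | k
    · simp
    · simp; ring
  have h3 : L ^ (2 * k) * (cub a b * A ^ 2 - C 2 * q * (cub a b * B + (C 6 * X ^ 2 - C (a / 2)) * L * A)
      + C 4 * (C M * X - C μ) * L ^ 2 * q ^ 2) = 0 := by
    rw [← hD, Dop]
    have e : p * (cub a b * derivative (derivative p)) = L ^ (2 * k) * (q * (cub a b * B)) := by
      calc _ = L ^ k * q * cub a b * (L * derivative (derivative p)) := by rw [hp]; ring
        _ = _ := by rw [h2]; ring
    have e2 : Dop a b M μ p = cub a b * derivative p ^ 2 - C 2 * (p * (cub a b * derivative (derivative p)))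
        - C 2 * p * ((C 6 * X ^ 2 - C (a / 2)) * derivative p) + C 4 * (C M * X - C μ) * p ^ 2 := by
      rw [Dop]; ring
    rw [← Dop, e2, e, h1, hp]; ring
  have h4 := (mul_eq_zero.1 h3).resolve_left (pow_ne_zero _ hL0)
  have eA : A.eval r = (k + 1) * q.eval r := by simp [hA, hL]
  have eB : B.eval r = k * ((k + 1) * q.eval r) := by simp [hB, eA, hL]
  have eL : L.eval r = 0 := by simp [hL]
  by_cases hQ : 4 * r ^ 3 - a * r - b = 0
  · right
    refine ⟨hQ, ?_⟩
    set E : ℂ[X] := C 4 * X ^ 2 + C (4 * r) * X + C (4 * r ^ 2 - a) with hE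
    have hcub : cub a b = L * E := by
      refine Polynomial.funext fun x => ?_
      simp [cub, hL, hE]
      linear_combination hQ
    have h5 : L * (E * A ^ 2 - C 2 * q * (E * B + (C 6 * X ^ 2 - C (a / 2)) * A)
      + C 4 * (C M * X - C μ) * L * q ^ 2) = 0 := by
      rw [← h4, hcub]; ring
    have h6 := congrArg (eval r) ((mul_eq_zero.1 h5).resolve_left hL0)
    have eE : E.eval r = 12 * r ^ 2 - a := by simp [hE]; ring
    simp only [eval_add, eval_sub, eval_mul, eval_pow, eval_C, eval_X, eA, eB, eL, eE,
      eval_zero] at h6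
    have h7 : (12 * r ^ 2 - a) * (q.eval r) ^ 2 * ((k : ℂ) * (k + 1)) = 0 := by
      linear_combination -h6
    have h8 := (mul_eq_zero.1 h7).resolve_left (mul_ne_zero (hs hQ) (pow_ne_zero 2 hq))
    have h9 : k * (k + 1) = 0 := by exact_mod_cast h8
    simpa using h9
  · left
    refine ⟨hQ, ?_⟩
    have h6 := congrArg (eval r) h4
    have eQ : (cub a b).eval r = 4 * r ^ 3 - a * r - b := by simp [cub]
    simp only [eval_add, eval_sub, eval_mul, eval_pow, eval_C, eval_X, eA, eB, eL, eQ,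
      eval_zero] at h6
    have h7 : (4 * r ^ 3 - a * r - b) * (q.eval r) ^ 2 * (((k : ℂ) + 1) * (1 - k)) = 0 := by
      linear_combination h6
    have h8 := (mul_eq_zero.1 h7).resolve_left (mul_ne_zero hQ (pow_ne_zero 2 hq))
    have h9 : ((k : ℤ) + 1) * (1 - k) = 0 := by exact_mod_cast h8
    rcases mul_eq_zero.1 h9 with h | h <;> omega

/-- the conclusion on the multiset of parameters -/
def GoodK (W : WeierstrassData) (p : ℂ[X]) (c : ℂ) (K : Multiset ℂ) : Prop :=
  (∀ k ∈ K, k ∉ W.lattice) ∧ p = (K.map (fun k => X - C (W.P k))).prod ∧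
    ∀ u : ℂ, p.eval u ≠ 0 → c = -(p.eval u) * (K.map (fun k => P' W k / (u - W.P k))).sum

theorem goodK_ne (W : WeierstrassData) (p : ℂ[X]) (c M μ : ℂ) (hmon : p.Monic)
    (hdeg : p.natDegree ≠ 0) (hc : c ≠ 0) (hD : Dop (g2 W) (g3 W) M μ p = C (c ^ 2)) :
    ∃ K, GoodK W p c K := by
  classical
  have hev : ∀ r, p.eval r = 0 →
      (4 * r ^ 3 - g2 W * r - g3 W) * (derivative p).eval r ^ 2 = c ^ 2 := by
    intro r hr
    have := congrArg (eval r) hD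
    simp only [Dop, cub, eval_add, eval_sub, eval_mul, eval_pow, eval_C, eval_X, hr] at this
    linear_combination this
  have hd : ∀ r, p.eval r = 0 → (derivative p).eval r ≠ 0 := by
    intro r hr h0
    have := hev r hr
    rw [h0] at this
    exact hc (by simpa using this.symm)
  have hnd : p.roots.Nodup := by
    rw [Multiset.nodup_iff_count_le_one]
    intro r
    rw [count_roots]
    by_contra h
    have := (one_lt_rootMultiplicity_iff_isRoot hmon.ne_zero).1 (not_le.1 h)
    exact hd r this.1 this.2
  have hκ : ∀ r, ∃ k, p.eval r = 0 → k ∉ W.lattice ∧ W.P k = r ∧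
      P' W k = -c / (derivative p).eval r := by
    intro r
    by_cases hr : p.eval r = 0
    swap
    · exact ⟨0, fun h => absurd h hr⟩
    obtain ⟨k, hk, hkr⟩ := P_surj W r
    have h1 := P'_sq W hk
    have h2 := hev r hr
    have h3 : (P' W k) ^ 2 = (-c / (derivative p).eval r) ^ 2 := by
      rw [h1, hkr, div_pow, eq_div_iff (pow_ne_zero 2 (hd r hr)), h2]; ring
    rcases sq_eq_sq_iff_eq_or_eq_neg.1 h3 with h | h
    · exact ⟨k, fun _ => ⟨hk, hkr, h⟩⟩
    · refine ⟨-k, fun _ => ⟨fun h' => hk ((neg_mem_iff W).1 h'), by rw [P_even W hk, hkr], ?_⟩⟩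
      rw [P'_odd W hk, h, neg_neg]
  choose κ hκ using hκ
  set s := p.roots.toFinset with hs
  have hsv : s.val = p.roots := by rw [hs, Multiset.toFinset_val, hnd.dedup]
  have hroot : ∀ r ∈ s, p.eval r = 0 := by
    intro r hr
    rw [hs, Multiset.mem_toFinset] at hr
    exact isRoot_of_mem_roots hr
  have hprod := (IsAlgClosed.splits p).eq_prod_roots_of_monic hmon
  have hnodal : Lagrange.nodal s id = p := by
    rw [hprod, Lagrange.nodal, Finset.prod, hsv]; rfl
  refine ⟨s.val.map κ, ?_, ?_, ?_⟩
  · intro k hk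
    obtain ⟨r, hr, rfl⟩ := Multiset.mem_map.1 hk
    exact (hκ r (hroot r hr)).1
  · conv_lhs => rw [hprod]
    rw [Multiset.map_map, hsv]
    congr 1
    refine Multiset.map_congr rfl fun r hr => ?_
    have : r ∈ s := by rw [hs, Multiset.mem_toFinset]; exact hr
    simp [(hκ r (hroot r this)).2.1]
  · intro u hu
    have hus : ∀ i ∈ s, u ≠ id i := by
      rintro i hi rfl
      exact hu (hroot _ hi)
    have hne : s.Nonempty := by
      rw [Finset.nonempty_iff_ne_empty]
      intro h
      rw [← hnodal, h] at hdeg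
      simp at hdeg
    have h1 := Lagrange.eval_interpolate_not_at_node (s := s) (v := id) (1 : ℂ → ℂ) hus
    rw [Lagrange.interpolate_one (Function.injective_id.injOn) hne, hnodal] at h1
    simp only [eval_one] at h1
    rw [Multiset.map_map]
    change c = -(p.eval u) * ∑ r ∈ s, ((fun k => P' W k / (u - W.P k)) ∘ κ) r
    have h2 : ∑ r ∈ s, ((fun k => P' W k / (u - W.P k)) ∘ κ) r
        = -c * ∑ i ∈ s, Lagrange.nodalWeight s id i * (u - id i)⁻¹ * (1 : ℂ → ℂ) i := by
      rw [Finset.mul_sum]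
      refine Finset.sum_congr rfl fun r hr => ?_
      have := hκ r (hroot r hr)
      simp only [Function.comp]
      rw [this.2.1, this.2.2, Lagrange.nodalWeight_eq_eval_derivative_nodal hr, hnodal]
      simp only [id, Pi.one_apply]
      rw [div_eq_mul_inv, div_eq_mul_inv]; ring
    rw [h2]
    linear_combination c * h1

theorem goodK_zero (W : WeierstrassData) (p : ℂ[X]) (M μ : ℂ) (hmon : p.Monic)
    (hD : Dop (g2 W) (g3 W) M μ p = 0) :
    ∃ K, GoodK W p 0 K := by
  classical
  choose κ hκ hκr using P_surj W
  set s := p.roots.toFinset with hs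
  have hroot : ∀ r ∈ s, p.eval r = 0 := by
    intro r hr
    rw [hs, Multiset.mem_toFinset] at hr
    exact isRoot_of_mem_roots hr
  have hprod := (IsAlgClosed.splits p).eq_prod_roots_of_monic hmon
  rw [Finset.prod_multiset_map_count] at hprod
  set t : ℂ → Multiset ℂ := fun r => if P' W (κ r) = 0 then {κ r} else {κ r, -κ r} with ht
  have hnk : ∀ r, -κ r ∉ W.lattice := fun r h => hκ r ((neg_mem_iff W).1 h)
  refine ⟨s.val.bind t, ?_, ?_, ?_⟩
  · intro k hk
    obtain ⟨r, hr, hkr⟩ := Multiset.mem_bind.1 hk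
    simp only [ht] at hkr
    split_ifs at hkr
    · rw [Multiset.mem_singleton] at hkr; rw [hkr]; exact hκ r
    · simp only [Multiset.insert_eq_cons, Multiset.mem_cons, Multiset.mem_singleton] at hkr
      rcases hkr with h | h <;> rw [h]
      · exact hκ r
      · exact hnk r
  · rw [Multiset.map_bind, Multiset.prod_bind]
    conv_lhs => rw [hprod]
    change ∏ r ∈ s, _ = ∏ r ∈ s, _
    refine Finset.prod_congr rfl fun r hr => ?_
    have hpos : 0 < rootMultiplicity r p := (rootMultiplicity_pos hmon.ne_zero).2 (hroot r hr)
    obtain ⟨q, hq, hdvd⟩ := exists_eq_pow_rootMultiplicity_mul_and_not_dvd p hmon.ne_zero r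
    obtain ⟨k, hk⟩ := Nat.exists_eq_succ_of_ne_zero hpos.ne'
    rw [count_roots, hk]
    rw [hk] at hq
    have hq0 : q.eval r ≠ 0 := fun h => hdvd (dvd_iff_isRoot.2 h)
    have hP' := P'_sq W (hκ r)
    rw [hκr] at hP'
    rcases mult_zero _ _ M μ r k p q hq hq0 hD (simple_roots W) with ⟨h1, h2⟩ | ⟨h1, h2⟩
    · have h3 : P' W (κ r) ≠ 0 := by
        intro h; rw [h] at hP'; exact h1 (by rw [← hP']; ring)
      simp [ht, h3, h2, hκr, P_even W (hκ r)]; ring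
    · have h3 : P' W (κ r) = 0 := by
        rw [h1] at hP'; exact pow_eq_zero_iff (two_ne_zero) |>.1 hP'
      simp [ht, h3, h2, hκr]
  · intro u hu
    rw [Multiset.map_bind, Multiset.sum_bind]
    have : (s.val.map fun r => ((t r).map (fun k => P' W k / (u - W.P k))).sum) =
        s.val.map fun _ => 0 := by
      refine Multiset.map_congr rfl fun r _ => ?_
      simp only [ht]
      split_ifs with h
      · simp [h]
      · simp [P_even W (hκ r), P'_odd W (hκ r), neg_div]
    rw [this]; simp

theorem exists_kv (W : WeierstrassData) (m : ℕ) (hm : 1 ≤ m) (μ : ℂ) :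
    ∃ (p : ℂ[X]) (c : ℂ) (kv : Fin m → ℂ), Dop (g2 W) (g3 W) (m * (m + 1)) μ p = C (c ^ 2) ∧
      (∀ j, kv j ∉ W.lattice) ∧ p = ∏ j, (X - C (W.P (kv j))) ∧
      ∀ u : ℂ, p.eval u ≠ 0 → c = -(p.eval u) * ∑ j, P' W (kv j) / (u - W.P (kv j)) := by
  obtain ⟨p, c, hmon, hdeg, hD⟩ := exists_poly (g2 W) (g3 W) μ m
  have : ∃ K, GoodK W p c K := by
    by_cases hc : c = 0
    · subst hc
      exact goodK_zero W p _ μ hmon (by rw [hD]; simp)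
    · exact goodK_ne W p c _ μ hmon (by omega) hc hD
  obtain ⟨K, h1, h2, h3⟩ := this
  have hcard : K.card = m := by
    have e := natDegree_multiset_prod_X_sub_C_eq_card (K.map W.P)
    rw [Multiset.map_map, Multiset.card_map] at e
    rw [← hdeg, h2, ← e]
    rfl
  have hl : K.toList.length = m := by rw [Multiset.length_toList, hcard]
  subst hl
  have hK : K = (Finset.univ.val.map (fun j => K.toList.get j) : Multiset ℂ) := by
    rw [Fin.univ_val_map]
    conv_lhs => rw [← Multiset.coe_toList K, ← List.ofFn_get K.toList]
  refine ⟨p, c, fun j => K.toList.get j, hD, ?_, ?_, ?_⟩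
  · intro j
    exact h1 _ (Multiset.mem_toList.1 (List.get_mem _ _))
  · conv_lhs => rw [h2, hK, Multiset.map_map]
    rfl
  · intro u hu
    have := h3 u hu
    conv at this => rhs; rw [hK, Multiset.map_map]
    exact this

end Poly3

section Hermite

/-- exceptional set attached to the parameters -/
def badSet (W : WeierstrassData) {m : ℕ} (kv : Fin m → ℂ) : Set ℂ :=
  W.lattice ∪ ⋃ j, ((fun z => z + kv j) ⁻¹' W.lattice ∪ (fun z => z - kv j) ⁻¹' W.lattice)

theorem not_mem_bad {W : WeierstrassData} {m : ℕ} {kv : Fin m → ℂ} {z : ℂ} :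
    z ∉ badSet W kv ↔ z ∉ W.lattice ∧ ∀ j, z + kv j ∉ W.lattice ∧ z - kv j ∉ W.lattice := by
  simp [badSet, not_or]

theorem bad_countable (W : WeierstrassData) {m : ℕ} (kv : Fin m → ℂ) :
    (badSet W kv).Countable := by
  refine (countable_lattice W).union (Set.countable_iUnion fun j => ?_)
  refine Set.Countable.union ?_ ?_
  · exact (countable_lattice W).preimage (add_left_injective (kv j))
  · exact (countable_lattice W).preimage (sub_left_injective (b := kv j))

theorem bad_closed (W : WeierstrassData) {m : ℕ} (kv : Fin m → ℂ) : IsClosed (badSet W kv) := by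
  refine (isClosed_lattice W).union (isClosed_iUnion_of_finite fun j => ?_)
  exact ((isClosed_lattice W).preimage (by fun_prop)).union
    ((isClosed_lattice W).preimage (by fun_prop))

theorem bad_neg {W : WeierstrassData} {m : ℕ} {kv : Fin m → ℂ} {z : ℂ} (hz : z ∉ badSet W kv) :
    -z ∉ badSet W kv := by
  rw [not_mem_bad] at hz ⊢
  refine ⟨fun h => hz.1 ((neg_mem_iff W).1 h), fun j => ⟨fun h => ?_, fun h => ?_⟩⟩
  · refine (hz.2 j).2 ((neg_mem_iff W).1 ?_)
    convert h using 1; ring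
  · refine (hz.2 j).1 ((neg_mem_iff W).1 ?_)
    convert h using 1; ring

theorem prod_logderiv {ι : Type*} (s : Finset ι) (f : ι → ℂ → ℂ) (r : ι → ℂ) (z : ℂ)
    (h : ∀ i ∈ s, HasDerivAt (f i) (r i * f i z) z) :
    HasDerivAt (fun z => ∏ i ∈ s, f i z) ((∑ i ∈ s, r i) * ∏ i ∈ s, f i z) z := by
  classical
  induction s using Finset.induction_on with
  | empty => simpa using hasDerivAt_const z (1 : ℂ)
  | insert a s ha ih =>
    simp only [Finset.prod_insert ha, Finset.sum_insert ha]
    have h1 := h a (Finset.mem_insert_self a s)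
    have h2 := ih fun i hi => h i (Finset.mem_insert_of_mem hi)
    refine (h1.mul h2).congr_deriv ?_
    ring

variable (W : WeierstrassData) {m : ℕ} (kv : Fin m → ℂ)

theorem H_analytic (hkv : ∀ j, kv j ∉ W.lattice) :
    AnalyticOnNhd ℂ (hermiteProd W m kv) W.latticeᶜ := by
  refine DifferentiableOn.analyticOnNhd ?_ (isOpen_compl W)
  intro z hz
  refine DifferentiableAt.differentiableWithinAt ?_
  unfold hermiteProd
  refine DifferentiableAt.mul ?_ (by fun_prop)
  refine DifferentiableAt.fun_finsetProd fun j _ => ?_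
  have h1 : DifferentiableAt ℂ (fun z => W.S (z + kv j)) z :=
    (W.S_diff (z + kv j)).comp z (by fun_prop)
  exact h1.div ((W.S_diff z).mul_const _) (mul_ne_zero (W.S_ne z hz) (W.S_ne _ (hkv j)))

theorem H_ne (hkv : ∀ j, kv j ∉ W.lattice) {z : ℂ} (hz : z ∉ badSet W kv) :
    hermiteProd W m kv z ≠ 0 := by
  rw [not_mem_bad] at hz
  unfold hermiteProd
  refine mul_ne_zero (Finset.prod_ne_zero_iff.2 fun j _ => ?_) (Complex.exp_ne_zero _)
  exact div_ne_zero (W.S_ne _ (hz.2 j).1) (mul_ne_zero (W.S_ne z hz.1) (W.S_ne _ (hkv j)))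

theorem H_hasDeriv (hkv : ∀ j, kv j ∉ W.lattice) {z : ℂ} (hz : z ∉ badSet W kv) :
    HasDerivAt (hermiteProd W m kv)
      ((∑ j, (W.Z (z + kv j) - W.Z z - W.Z (kv j))) * hermiteProd W m kv z) z := by
  rw [not_mem_bad] at hz
  have h1 := prod_logderiv Finset.univ (fun j z => W.S (z + kv j) / (W.S z * W.S (kv j)))
    (fun j => W.Z (z + kv j) - W.Z z) z (fun j _ => by
      have a1 : HasDerivAt (fun z => W.S (z + kv j)) (W.Z (z + kv j) * W.S (z + kv j)) z := by
        simpa using (S_hasDeriv W (hz.2 j).1).comp_add_const z (kv j)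
      have a2 := (S_hasDeriv W hz.1).mul_const (W.S (kv j))
      have n1 := W.S_ne z hz.1
      have n2 := W.S_ne _ (hkv j)
      refine (a1.div a2 (mul_ne_zero n1 n2)).congr_deriv ?_
      field_simp)
  have h2 : HasDerivAt (fun z => Complex.exp (-(∑ j, W.Z (kv j)) * z))
      (Complex.exp (-(∑ j, W.Z (kv j)) * z) * (-(∑ j, W.Z (kv j)) * 1)) z :=
    ((hasDerivAt_id z).const_mul _).cexp
  have h3 := h1.mul h2
  refine h3.congr_deriv ?_
  simp only [hermiteProd, Finset.sum_sub_distrib]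
  ring

open Polynomial in
theorem hermite_ode (p : ℂ[X]) (c M μ : ℂ) (hD : Dop (g2 W) (g3 W) M μ p = C (c ^ 2))
    (hkv : ∀ j, kv j ∉ W.lattice) (hp : p = ∏ j, (X - C (W.P (kv j))))
    (hc : ∀ u : ℂ, p.eval u ≠ 0 → c = -(p.eval u) * ∑ j, P' W (kv j) / (u - W.P (kv j)))
    {z : ℂ} (hz : z ∉ badSet W kv) :
    -deriv (deriv (hermiteProd W m kv)) z + M * W.P z * hermiteProd W m kv z
      = μ * hermiteProd W m kv z := by
  have hX : ∀ y ∉ badSet W kv, p.eval (W.P y) ≠ 0 := by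
    intro y hy
    rw [not_mem_bad] at hy
    rw [hp, eval_prod, Finset.prod_ne_zero_iff]
    intro j _ h
    simp only [eval_sub, eval_X, eval_C] at h
    rcases P_eq_iff W (hkv j) hy.1 (sub_eq_zero.1 h) with h | h
    · exact (hy.2 j).1 h
    · exact (hy.2 j).2 h
  have hXd : ∀ y ∉ W.lattice, HasDerivAt (fun y => p.eval (W.P y))
      ((derivative p).eval (W.P y) * P' W y) y := fun y hy =>
    (p.hasDerivAt (W.P y)).comp y (P_hasDeriv W hy)
  have hR : ∀ y ∉ badSet W kv, (∑ j, (W.Z (y + kv j) - W.Z y - W.Z (kv j)))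
      = ((derivative p).eval (W.P y) * P' W y + c) / (2 * p.eval (W.P y)) := by
    intro y hy
    have hXy := hX y hy
    have hcy := hc _ hXy
    have hy' := not_mem_bad.1 hy
    have hne : ∀ j, W.P y - W.P (kv j) ≠ 0 := by
      intro j h
      rcases P_eq_iff W (hkv j) hy'.1 (sub_eq_zero.1 h) with h | h
      · exact (hy'.2 j).1 h
      · exact (hy'.2 j).2 h
    have hd := prod_logderiv Finset.univ (fun j y => W.P y - W.P (kv j))
      (fun j => P' W y / (W.P y - W.P (kv j))) y (fun j _ => by
        rw [div_mul_cancel₀ _ (hne j)]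
        exact (P_hasDeriv W hy'.1).sub_const _)
    have he : (fun y => ∏ j, (W.P y - W.P (kv j))) = fun y => p.eval (W.P y) := by
      funext y; rw [hp, eval_prod]; simp
    rw [he] at hd
    have hu := (hXd y hy'.1).unique hd
    have he' : ∏ j, (W.P y - W.P (kv j)) = p.eval (W.P y) := congrFun he y
    rw [he'] at hu
    rw [hu]
    conv_rhs => rw [hcy]
    have e1 : ∑ j, (W.Z (y + kv j) - W.Z y - W.Z (kv j))
        = (∑ j, P' W y / (W.P y - W.P (kv j)) - ∑ j, P' W (kv j) / (W.P y - W.P (kv j))) / 2 := by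
      rw [← Finset.sum_sub_distrib, Finset.sum_div]
      refine Finset.sum_congr rfl fun j _ => ?_
      rw [zeta_add W (hkv j) hy'.1 (hy'.2 j).1 (hy'.2 j).2]
      have := hne j
      field_simp
    rw [e1]
    field_simp
    ring
  set H := hermiteProd W m kv with hH
  have hopen : (badSet W kv)ᶜ ∈ 𝓝 z := (bad_closed W kv).isOpen_compl.mem_nhds hz
  have hev : deriv H =ᶠ[𝓝 z] fun y =>
      (((derivative p).eval (W.P y) * P' W y + c) / (2 * p.eval (W.P y))) * H y := by
    filter_upwards [hopen] with y hy
    rw [(H_hasDeriv W kv hkv hy).deriv, hR y hy]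
  have hz' := (not_mem_bad.1 hz).1
  have hXz := hX z hz
  have d1 : HasDerivAt (fun y => (derivative p).eval (W.P y) * P' W y + c) _ z :=
    ((((derivative p).hasDerivAt (W.P z)).comp z (P_hasDeriv W hz')).mul
      (P'_hasDeriv W hz')).add_const c
  have d2 := (d1.div ((hXd z hz').const_mul 2) (mul_ne_zero two_ne_zero hXz)).mul
    (H_hasDeriv W kv hkv hz)
  rw [hev.deriv_eq]
  have d3 := d2.deriv
  simp only [Pi.mul_def, Pi.div_def, Function.comp_def] at d3
  rw [d3, hR z hz]
  have hDz := congrArg (eval (W.P z)) hD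
  simp only [Dop, cub, eval_add, eval_sub, eval_mul, eval_pow, eval_C, eval_X] at hDz
  rw [← P'_sq W hz'] at hDz
  rw [← hH]
  field_simp
  generalize eval (W.P z) p = x at *
  linear_combination (H z) * hDz

theorem hermite_exists (W : WeierstrassData) (m : ℕ) (hm : 1 ≤ m) (μ : ℂ) :
    ∃ kv : Fin m → ℂ, (∀ j, kv j ∉ W.lattice) ∧ ∀ z ∉ W.lattice,
      -deriv (deriv (hermiteProd W m kv)) z + (m * (m + 1) : ℂ) * W.P z * hermiteProd W m kv z
      = μ * hermiteProd W m kv z := by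
  obtain ⟨p, c, kv, hD, hkv, hp, hc⟩ := exists_kv W m hm μ
  refine ⟨kv, hkv, ?_⟩
  have hA := H_analytic W kv hkv
  have hs : (badSet W kv)ᶜ ⊆ W.latticeᶜ := fun z hz => (not_mem_bad.1 hz).1
  have h1 : EqOn (fun z => -deriv (deriv (hermiteProd W m kv)) z
      + (m * (m + 1) : ℂ) * W.P z * hermiteProd W m kv z)
      (fun z => μ * hermiteProd W m kv z) (badSet W kv)ᶜ := fun z hz =>
    hermite_ode W kv p c _ μ hD hkv hp hc hz
  have c1 := hA.continuousOn
  have c2 := hA.deriv.deriv.continuousOn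
  have c3 := (P_analytic W).continuousOn
  have h2 := h1.of_subset_closure (t := W.latticeᶜ) (by fun_prop) (by fun_prop) hs
    (fun z _ => dense_c (bad_countable W kv) z)
  exact fun z hz => h2 hz

end Hermite

section Main

theorem H_quasi (W : WeierstrassData) {ω : ℂ} (hω : 2 * ω ∈ W.lattice) (hω' : ω ∉ W.lattice)
    {m : ℕ} (kv : Fin m → ℂ) (z : ℂ) :
    hermiteProd W m kv (z + 2 * ω)
      = Complex.exp (2 * (W.Z ω * (∑ j, kv j) - ω * ∑ j, W.Z (kv j))) * hermiteProd W m kv z := by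
  obtain ⟨η, hη⟩ := Z_quasi W hω
  have hη2 : η = 2 * W.Z ω := by
    have h := hη (-ω) (fun h => hω' ((neg_mem_iff W).1 h))
    have e : -ω + 2 * ω = ω := by ring
    rw [e, W.Z_odd] at h
    linear_combination -h
  obtain ⟨A, hA, hS⟩ := S_quasi_of W hω hη
  have h1 : ∀ j, W.S (z + 2 * ω + kv j) / (W.S (z + 2 * ω) * W.S (kv j))
      = Complex.exp (η * kv j) * (W.S (z + kv j) / (W.S z * W.S (kv j))) := by
    intro j
    have e : z + 2 * ω + kv j = (z + kv j) + 2 * ω := by ring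
    rw [e, hS, hS, mul_add, Complex.exp_add]
    have hn : A * Complex.exp (η * z) ≠ 0 := mul_ne_zero hA (Complex.exp_ne_zero _)
    have e2 : A * (Complex.exp (η * z) * Complex.exp (η * kv j)) * W.S (z + kv j)
        = (A * Complex.exp (η * z)) * (Complex.exp (η * kv j) * W.S (z + kv j)) := by ring
    rw [e2, mul_assoc (A * Complex.exp (η * z)), mul_div_mul_left _ _ hn, mul_div_assoc]
  unfold hermiteProd
  rw [Finset.prod_congr rfl fun j _ => h1 j, Finset.prod_mul_distrib, ← Complex.exp_sum,
    ← Finset.mul_sum, hη2]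
  have e3 : Complex.exp (-(∑ j, W.Z (kv j)) * (z + 2 * ω))
      = Complex.exp (-(2 * ω * ∑ j, W.Z (kv j))) * Complex.exp (-(∑ j, W.Z (kv j)) * z) := by
    rw [← Complex.exp_add]; congr 1; ring
  have e4 : Complex.exp (2 * (W.Z ω * (∑ j, kv j) - ω * ∑ j, W.Z (kv j)))
      = Complex.exp (2 * W.Z ω * ∑ j, kv j) * Complex.exp (-(2 * ω * ∑ j, W.Z (kv j))) := by
    rw [← Complex.exp_add]; congr 1; ring
  rw [e3, e4]; ring

theorem line_deriv {U : Set ℂ} {ψ : ℂ → ℂ} (hψ : AnalyticOnNhd ℂ ψ U) (ω z0 : ℂ)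
    (hz0 : ∀ x : ℝ, ω * x + z0 ∈ U) (x : ℝ) :
    HasDerivAt (fun x : ℝ => ψ (ω * x + z0)) (ω * deriv ψ (ω * x + z0)) x := by
  have h1 : HasDerivAt (fun x : ℝ => ω * (x : ℂ) + z0) ω x := by
    simpa using ((Complex.ofRealCLM.hasDerivAt (x := x)).const_mul ω).add_const z0
  have h2 := (hψ _ (hz0 x)).differentiableAt.hasDerivAt
  have h3 := HasDerivAt.comp x (h₂ := ψ) (h := fun x : ℝ => ω * (x : ℂ) + z0) h2 h1
  refine h3.congr_deriv ?_
  ring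

theorem line_contDiff {U : Set ℂ} {ψ : ℂ → ℂ} (hψ : AnalyticOnNhd ℂ ψ U) (ω z0 : ℂ)
    (hz0 : ∀ x : ℝ, ω * x + z0 ∈ U) : ContDiff ℝ 2 (fun x : ℝ => ψ (ω * x + z0)) := by
  rw [contDiff_iff_contDiffAt]
  intro x
  have h1 : ContDiffAt ℝ 2 (fun x : ℝ => ω * (x : ℂ) + z0) x := by
    have : ContDiff ℝ 2 (fun x : ℝ => (x : ℂ)) := Complex.ofRealCLM.contDiff
    exact ((contDiff_const.mul this).add contDiff_const).contDiffAt
  have h2 : ContDiffAt ℝ 2 ψ (ω * (x : ℂ) + z0) :=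
    (hψ _ (hz0 x)).contDiffAt.restrict_scalars ℝ
  exact h2.comp x h1

theorem wronskian {f f1 g g1 q : ℝ → ℂ} (hf : ∀ x, HasDerivAt f (f1 x) x)
    (hf1 : ∀ x, HasDerivAt f1 (q x * f x) x) (hg : ∀ x, HasDerivAt g (g1 x) x)
    (hg1 : ∀ x, HasDerivAt g1 (q x * g x) x) (x y : ℝ) :
    f x * g1 x - f1 x * g x = f y * g1 y - f1 y * g y := by
  have h : ∀ x, HasDerivAt (fun x => f x * g1 x - f1 x * g x) 0 x := by
    intro x
    refine (((hf x).mul (hg1 x)).sub ((hf1 x).mul (hg x))).congr_deriv ?_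
    ring
  exact is_const_of_deriv_eq_zero (fun x => (h x).differentiableAt) (fun x => (h x).deriv) x y

theorem bounded_zero {E u v : ℂ} {C : ℝ} (hE : 1 < ‖E‖)
    (h : ∀ n : ℕ, ‖E ^ n * u + E⁻¹ ^ n * v‖ ≤ C) : u = 0 := by
  by_contra hu
  have hpos : 0 < ‖u‖ := norm_pos_iff.2 hu
  obtain ⟨n, hn⟩ := pow_unbounded_of_one_lt ((C + ‖v‖) / ‖u‖) hE
  have h1 := h n
  have h2 : ‖E⁻¹ ^ n * v‖ ≤ ‖v‖ := by
    rw [norm_mul, norm_pow, norm_inv]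
    have : (‖E‖⁻¹) ^ n ≤ 1 := pow_le_one₀ (by positivity) (inv_le_one_of_one_le₀ hE.le)
    nlinarith [norm_nonneg v]
  have h3 : ‖E ^ n * u‖ ≤ C + ‖v‖ := by
    have : E ^ n * u = (E ^ n * u + E⁻¹ ^ n * v) - E⁻¹ ^ n * v := by ring
    rw [this]
    exact (norm_sub_le _ _).trans (by linarith)
  rw [norm_mul, norm_pow] at h3
  rw [div_lt_iff₀ hpos] at hn
  linarith

theorem kill {A B : ℝ → ℂ} {E : ℂ} {C : ℝ} (hE : 1 < ‖E‖) (hA : ∀ x, A (x + 2) = E * A x)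
    (hB : ∀ x, B (x + 2) = E⁻¹ * B x) (h : ∀ x, ‖A x + B x‖ ≤ C) (x : ℝ) :
    A x = 0 ∧ B x = 0 := by
  have hE0 : E ≠ 0 := by
    rintro rfl; simp at hE; linarith
  have hA1 : ∀ n : ℕ, ∀ x, A (x + 2 * n) = E ^ n * A x := by
    intro n
    induction n with
    | zero => simp
    | succ n ih =>
      intro x
      have : x + 2 * ((n + 1 : ℕ) : ℝ) = (x + 2 * n) + 2 := by push_cast; ring
      rw [this, hA, ih]; ring
  have hB1 : ∀ n : ℕ, ∀ x, B (x + 2 * n) = E⁻¹ ^ n * B x := by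
    intro n
    induction n with
    | zero => simp
    | succ n ih =>
      intro x
      have : x + 2 * ((n + 1 : ℕ) : ℝ) = (x + 2 * n) + 2 := by push_cast; ring
      rw [this, hB, ih]; ring
  have hA2 : ∀ n : ℕ, ∀ x, A (x - 2 * n) = E⁻¹ ^ n * A x := by
    intro n x
    have := hA1 n (x - 2 * n)
    rw [sub_add_cancel] at this
    rw [this, ← mul_assoc, ← mul_pow, inv_mul_cancel₀ hE0, one_pow, one_mul]
  have hB2 : ∀ n : ℕ, ∀ x, B (x - 2 * n) = E ^ n * B x := by
    intro n x
    have := hB1 n (x - 2 * n)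
    rw [sub_add_cancel] at this
    rw [this, ← mul_assoc, ← mul_pow, mul_inv_cancel₀ hE0, one_pow, one_mul]
  refine ⟨bounded_zero (v := B x) (C := C) hE fun n => ?_,
    bounded_zero (v := A x) (C := C) hE fun n => ?_⟩
  · rw [← hA1, ← hB1]; exact h _
  · rw [← hA2, ← hB2, add_comm]; exact h _

theorem bad_periodic {W : WeierstrassData} {ω : ℂ} (hω : 2 * ω ∈ W.lattice) {m : ℕ}
    {kv : Fin m → ℂ} {z : ℂ} (hz : z ∉ badSet W kv) : z + 2 * ω ∉ badSet W kv := by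
  rw [not_mem_bad] at hz ⊢
  refine ⟨fun h => hz.1 ((add_mem_iff W hω).1 h), fun j => ⟨fun h => ?_, fun h => ?_⟩⟩
  · refine (hz.2 j).1 ((add_mem_iff W hω).1 ?_)
    convert h using 1; ring
  · refine (hz.2 j).2 ((add_mem_iff W hω).1 ?_)
    convert h using 1; ring

theorem G_analytic (W : WeierstrassData) {m : ℕ} (kv : Fin m → ℂ)
    (hkv : ∀ j, kv j ∉ W.lattice) :
    AnalyticOnNhd ℂ (fun z => hermiteProd W m kv (-z)) W.latticeᶜ := by
  intro z hz
  have h := H_analytic W kv hkv (-z) (fun h => hz ((neg_mem_iff W).1 h))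
  exact AnalyticAt.fun_comp (g := hermiteProd W m kv) (f := fun z => -z) h analyticAt_id.neg

theorem G_deriv2 (H : ℂ → ℂ) :
    deriv (fun z => H (-z)) = (fun z => - deriv H (-z)) ∧
    deriv (deriv (fun z => H (-z))) = fun z => deriv (deriv H) (-z) := by
  have h1 : ∀ H : ℂ → ℂ, deriv (fun z => H (-z)) = fun z => - deriv H (-z) := by
    intro H; funext z; exact deriv_comp_neg H z
  refine ⟨h1 H, ?_⟩
  rw [h1 H]
  funext z
  have := congrFun (h1 (deriv H)) z
  rw [deriv.fun_neg, this, neg_neg]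

theorem complex_wronskian_ne (W : WeierstrassData) {ω : ℂ} (hω : 2 * ω ∈ W.lattice)
    (hω' : ω ∉ W.lattice) {m : ℕ} (kv : Fin m → ℂ) (hkv : ∀ j, kv j ∉ W.lattice) (M μ : ℂ)
    (hode : ∀ z ∉ W.lattice, -deriv (deriv (hermiteProd W m kv)) z
      + M * W.P z * hermiteProd W m kv z = μ * hermiteProd W m kv z)
    (hf : (W.Z ω * (∑ j, kv j) - ω * ∑ j, W.Z (kv j)).re ≠ 0) {z0 : ℂ} (hz0 : z0 ∉ W.lattice) :
    hermiteProd W m kv z0 * deriv (fun z => hermiteProd W m kv (-z)) z0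
      - deriv (hermiteProd W m kv) z0 * hermiteProd W m kv (-z0) ≠ 0 := by
  intro h0
  have hqp := H_quasi W hω hω' kv
  set f := W.Z ω * (∑ j, kv j) - ω * ∑ j, W.Z (kv j) with hfdef
  have hHa := H_analytic W kv hkv
  have hGa := G_analytic W kv hkv
  have hne := fun z => H_ne W kv hkv (z := z)
  set H := hermiteProd W m kv with hH
  set G : ℂ → ℂ := fun z => H (-z) with hG
  have hd2 : deriv (deriv G) = fun z => deriv (deriv H) (-z) := (G_deriv2 H).2
  have hV : ∀ z ∉ W.lattice, HasDerivAt (fun z => H z * deriv G z - deriv H z * G z) 0 z := by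
    intro z hz
    have a1 := (hHa z hz).differentiableAt.hasDerivAt
    have a2 := (hHa.deriv z hz).differentiableAt.hasDerivAt
    have b1 := (hGa z hz).differentiableAt.hasDerivAt
    have b2 := (hGa.deriv z hz).differentiableAt.hasDerivAt
    refine ((a1.mul b2).sub (a2.mul b1)).congr_deriv ?_
    rw [hd2]
    have e1 := hode z hz
    have e2 := hode (-z) (fun h => hz ((neg_mem_iff W).1 h))
    rw [P_even W hz] at e2
    simp only [hG]
    linear_combination H (-z) * e1 - H z * e2
  have hV0 : ∀ z ∉ W.lattice, H z * deriv G z - deriv H z * G z = 0 := by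
    intro z hz
    have := const_of_deriv (countable_lattice W) (isClosed_lattice W) hV hz hz0
    exact this.trans h0
  have hq : ∀ z ∉ badSet W kv, HasDerivAt (fun z => G z / H z) 0 z := by
    intro z hz
    have hz' := (not_mem_bad.1 hz).1
    have a1 := (hHa z hz').differentiableAt.hasDerivAt
    have b1 := (hGa z hz').differentiableAt.hasDerivAt
    refine (b1.div a1 (hne z hz)).congr_deriv ?_
    have : deriv G z * H z - G z * deriv H z = 0 := by linear_combination hV0 z hz'
    rw [this, zero_div]
  obtain ⟨z, hz⟩ := (dense_c (bad_countable W kv)).nonempty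
  have hc := const_of_deriv (bad_countable W kv) (bad_closed W kv) hq (bad_periodic hω hz) hz
  have n1 := hne z hz
  have n2 := hne (-z) (bad_neg hz)
  have e1 : H (-z) = Complex.exp (2 * f) * G (z + 2 * ω) := by
    rw [hG, ← hqp]; congr 1; ring
  have hn := Complex.exp_ne_zero (2 * f)
  have n3 : G (z + 2 * ω) ≠ 0 := fun h => n2 (by rw [e1, h, mul_zero])
  have e2 : G (z + 2 * ω) / (Complex.exp (2 * f) * H z) = Complex.exp (2 * f) * G (z + 2 * ω) / H z := by
    rw [← hqp, ← e1]; exact hc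
  have e3 : Complex.exp (2 * f) * Complex.exp (2 * f) = 1 := by
    field_simp at e2
    have : G (z + 2 * ω) * (Complex.exp (2 * f) * Complex.exp (2 * f) - 1) = 0 := by
      linear_combination -G (z + 2 * ω) * e2
    have := (mul_eq_zero.1 this).resolve_left n3
    linear_combination this
  have e4 := congrArg norm e3
  rw [← Complex.exp_add, Complex.norm_exp, norm_one, Real.exp_eq_one_iff] at e4
  apply hf
  simp at e4
  linarith

end Main

section Final

theorem omega_ne {W : WeierstrassData} {ω : ℂ} (hω' : ω ∉ W.lattice) : ω ≠ 0 := by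
  rintro rfl
  exact hω' (zero_mem W)

theorem mem_spectrum_of (W : WeierstrassData) {ω : ℂ} (hω : 2 * ω ∈ W.lattice)
    (hω' : ω ∉ W.lattice) {m : ℕ} {z0 : ℂ} (hz0 : ∀ x : ℝ, ω * x + z0 ∉ W.lattice) (lam : ℂ)
    (kv : Fin m → ℂ) (hkv : ∀ j, kv j ∉ W.lattice)
    (hode : ∀ z ∉ W.lattice, -deriv (deriv (hermiteProd W m kv)) z
      + (m * (m + 1) : ℂ) * W.P z * hermiteProd W m kv z
        = (lam / ω ^ 2) * hermiteProd W m kv z)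
    (hf : (W.Z ω * (∑ j, kv j) - ω * ∑ j, W.Z (kv j)).re = 0) :
    lam ∈ W.lameSpectrum m ω z0 := by
  have hω0 := omega_ne hω'
  have hHa := H_analytic W kv hkv
  refine ⟨fun x => hermiteProd W m kv (ω * x + z0), ?_, line_contDiff hHa ω z0 hz0, ?_, ?_⟩
  · intro h
    have hsub : ∀ x : ℝ, ω * x + z0 ∈ badSet W kv := by
      intro x
      by_contra hx
      exact H_ne W kv hkv hx (congrFun h x)
    have hinj : Function.Injective (fun x : ℝ => ω * (x : ℂ) + z0) := by
      intro x y hxy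
      simpa [hω0] using hxy
    have hcount := (bad_countable W kv).preimage hinj
    have : (fun x : ℝ => ω * (x : ℂ) + z0) ⁻¹' badSet W kv = univ := eq_univ_of_forall hsub
    rw [this] at hcount
    exact not_countable_univ hcount
  · intro x
    have d1 : deriv (fun x : ℝ => hermiteProd W m kv (ω * x + z0))
        = fun x : ℝ => ω * deriv (hermiteProd W m kv) (ω * x + z0) :=
      funext fun x => (line_deriv hHa ω z0 hz0 x).deriv
    rw [d1, ((line_deriv hHa.deriv ω z0 hz0 x).const_mul ω).deriv]
    have := hode _ (hz0 x)
    field_simp at this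
    simp only
    linear_combination this
  · set φ : ℝ → ℂ := fun x => hermiteProd W m kv (ω * x + z0) with hφ
    have hp : Function.Periodic (fun x => ‖φ x‖) 2 := by
      intro x
      have e : ω * ((x + 2 : ℝ) : ℂ) + z0 = (ω * x + z0) + 2 * ω := by push_cast; ring
      simp only [hφ]
      rw [e, H_quasi W hω hω', norm_mul, Complex.norm_exp]
      have : (2 * (W.Z ω * (∑ j, kv j) - ω * ∑ j, W.Z (kv j))).re = 0 := by
        rw [Complex.mul_re, hf]; simp
      rw [this, Real.exp_zero, one_mul]
    have hcont : Continuous (fun x => ‖φ x‖) := (line_contDiff hHa ω z0 hz0).continuous.norm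
    obtain ⟨C, hC⟩ := (hp.isBounded_of_continuous two_ne_zero hcont).exists_norm_le
    refine ⟨C, fun x => ?_⟩
    have := hC _ (mem_range_self x)
    simpa using this

theorem of_mem_spectrum (W : WeierstrassData) {ω : ℂ} (hω : 2 * ω ∈ W.lattice)
    (hω' : ω ∉ W.lattice) {m : ℕ} {z0 : ℂ} (hz0 : ∀ x : ℝ, ω * x + z0 ∉ W.lattice) (lam : ℂ)
    (kv : Fin m → ℂ) (hkv : ∀ j, kv j ∉ W.lattice)
    (hode : ∀ z ∉ W.lattice, -deriv (deriv (hermiteProd W m kv)) z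
      + (m * (m + 1) : ℂ) * W.P z * hermiteProd W m kv z
        = (lam / ω ^ 2) * hermiteProd W m kv z)
    (hmem : lam ∈ W.lameSpectrum m ω z0) :
    (W.Z ω * (∑ j, kv j) - ω * ∑ j, W.Z (kv j)).re = 0 := by
  by_contra hf
  obtain ⟨φ, hφ0, hφc, hφe, C, hC⟩ := hmem
  have hω0 := omega_ne hω'
  have hz00 : z0 ∉ W.lattice := by simpa using hz0 0
  have hwr := complex_wronskian_ne W hω hω' kv hkv _ _ hode hf hz00
  have hqp := H_quasi W hω hω' kv
  set f := W.Z ω * (∑ j, kv j) - ω * ∑ j, W.Z (kv j) with hfdef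
  have hHa := H_analytic W kv hkv
  have hGa := G_analytic W kv hkv
  set H := hermiteProd W m kv with hH
  set G : ℂ → ℂ := fun z => H (-z) with hG
  have hd2 : deriv (deriv G) = fun z => deriv (deriv H) (-z) := (G_deriv2 H).2
  set q : ℝ → ℂ := fun x => (m * (m + 1) : ℂ) * ω ^ 2 * W.P (ω * x + z0) - lam with hq
  have p1 : ∀ x, HasDerivAt φ (deriv φ x) x := fun x =>
    (hφc.differentiable (by norm_num) x).hasDerivAt
  have p2 : ∀ x, HasDerivAt (deriv φ) (q x * φ x) x := by
    intro x
    have hd : ContDiff ℝ 1 (deriv φ) := by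
      have : ContDiff ℝ (1 + 1) φ := by simpa [one_add_one_eq_two] using hφc
      exact (contDiff_succ_iff_deriv.1 this).2.2
    refine (hd.differentiable (by norm_num) x).hasDerivAt.congr_deriv ?_
    simp only [hq]
    linear_combination -(hφe x)
  have a1 := fun x => line_deriv hHa ω z0 hz0 x
  have a2 : ∀ x : ℝ, HasDerivAt (fun x : ℝ => ω * deriv H (ω * x + z0)) (q x * H (ω * x + z0)) x := by
    intro x
    refine ((line_deriv hHa.deriv ω z0 hz0 x).const_mul ω).congr_deriv ?_
    have := hode _ (hz0 x)
    field_simp at this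
    simp only [hq]
    linear_combination -this
  have b1 := fun x => line_deriv hGa ω z0 hz0 x
  have b2 : ∀ x : ℝ, HasDerivAt (fun x : ℝ => ω * deriv G (ω * x + z0)) (q x * G (ω * x + z0)) x := by
    intro x
    refine ((line_deriv hGa.deriv ω z0 hz0 x).const_mul ω).congr_deriv ?_
    have := hode (-(ω * x + z0)) (fun h => hz0 x ((neg_mem_iff W).1 h))
    rw [P_even W (hz0 x)] at this
    rw [hd2]
    field_simp at this
    simp only [hq, hG]
    linear_combination -this
  have w0 := fun x => wronskian a1 a2 b1 b2 x 0
  have w1 := fun x => wronskian p1 p2 b1 b2 x 0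
  have w2 := fun x => wronskian a1 a2 p1 p2 x 0
  simp only [ofReal_zero, mul_zero, zero_add] at w0
  set w := H z0 * (ω * deriv G z0) - ω * deriv H z0 * G z0 with hw
  have hw0 : w ≠ 0 := by
    have : w = ω * (H z0 * deriv G z0 - deriv H z0 * G z0) := by rw [hw]; ring
    rw [this]; exact mul_ne_zero hω0 hwr
  generalize φ 0 * (ω * deriv G (ω * (0 : ℝ) + z0)) - deriv φ 0 * G (ω * (0 : ℝ) + z0) = u1 at w1
  generalize H (ω * (0 : ℝ) + z0) * deriv φ 0 - ω * deriv H (ω * (0 : ℝ) + z0) * φ 0 = u2 at w2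
  have key : ∀ x : ℝ, u1 * H (ω * x + z0) + u2 * G (ω * x + z0) = φ x * w := by
    intro x
    rw [← w0 x, ← w1 x, ← w2 x]; ring
  have hA : ∀ x : ℝ, u1 * H (ω * (x + 2 : ℝ) + z0) = Complex.exp (2 * f) * (u1 * H (ω * x + z0)) := by
    intro x
    have e : ω * ((x + 2 : ℝ) : ℂ) + z0 = (ω * x + z0) + 2 * ω := by push_cast; ring
    rw [e, hqp]; ring
  have hB : ∀ x : ℝ, u2 * G (ω * (x + 2 : ℝ) + z0)
      = (Complex.exp (2 * f))⁻¹ * (u2 * G (ω * x + z0)) := by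
    intro x
    have e : -(ω * (x : ℂ) + z0) = -(ω * ((x + 2 : ℝ) : ℂ) + z0) + 2 * ω := by push_cast; ring
    simp only [hG]
    rw [e, hqp]
    have := Complex.exp_ne_zero (2 * f)
    field_simp
  have hbd : ∀ x : ℝ, ‖u1 * H (ω * x + z0) + u2 * G (ω * x + z0)‖ ≤ C * ‖w‖ := by
    intro x
    rw [key, norm_mul]
    exact mul_le_mul_of_nonneg_right (hC x) (norm_nonneg _)
  have hzero : ∀ x : ℝ, u1 * H (ω * x + z0) = 0 ∧ u2 * G (ω * x + z0) = 0 := by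
    have hre : (2 * f).re = 2 * f.re := by simp
    intro x
    rcases lt_or_gt_of_ne hf with h | h
    · have hE : 1 < ‖(Complex.exp (2 * f))⁻¹‖ := by
        rw [← Complex.exp_neg, Complex.norm_exp, Real.one_lt_exp_iff, Complex.neg_re, hre]
        linarith
      exact (kill (A := fun x : ℝ => u2 * G (ω * x + z0)) (B := fun x : ℝ => u1 * H (ω * x + z0))
        hE hB (by simpa using hA) (fun x => by rw [add_comm]; exact hbd x) x).symm
    · have hE : 1 < ‖Complex.exp (2 * f)‖ := by
        rw [Complex.norm_exp, Real.one_lt_exp_iff, hre]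
        linarith
      exact kill (A := fun x : ℝ => u1 * H (ω * x + z0)) (B := fun x : ℝ => u2 * G (ω * x + z0))
        hE hA hB hbd x
  apply hφ0
  funext x
  have := key x
  rw [(hzero x).1, (hzero x).2, add_zero] at this
  exact (mul_eq_zero.1 this.symm).resolve_right hw0

theorem spectrum_eq (W : WeierstrassData) {ω : ℂ} (hω : 2 * ω ∈ W.lattice)
    (hω' : ω ∉ W.lattice) (m : ℕ) (hm : 1 ≤ m) {z0 : ℂ}
    (hz0 : ∀ x : ℝ, ω * x + z0 ∉ W.lattice) :
    W.lameSpectrum m ω z0 =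
      {lam : ℂ | ∃ kv : Fin m → ℂ, (∀ j, kv j ∉ W.lattice) ∧
        (∀ z ∉ W.lattice,
          -deriv (deriv (hermiteProd W m kv)) z
            + (m * (m + 1) : ℂ) * W.P z * hermiteProd W m kv z
            = (lam / ω ^ 2) * hermiteProd W m kv z) ∧
        (W.Z ω * (∑ j, kv j) - ω * ∑ j, W.Z (kv j)).re = 0} := by
  ext lam
  constructor
  · intro h
    obtain ⟨kv, hkv, hode⟩ := hermite_exists W m hm (lam / ω ^ 2)
    exact ⟨kv, hkv, hode, of_mem_spectrum W hω hω' hz0 lam kv hkv hode h⟩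
  · rintro ⟨kv, hkv, hode, hf⟩
    exact mem_spectrum_of W hω hω' hz0 lam kv hkv hode hf

end Final

end LameAux

/-- The spectrum of the complex Lamé operator
`L = -d²/dx² + m(m+1)ω²℘(ωx+z₀)` in `L²(ℝ)` does not depend on `z₀`, and it is
the set of those `λ` for which `Re[f_m(λ)] = 0`, where
`f_m = ζ(ω)·∑ⱼ kⱼ - ω·∑ⱼ ζ(kⱼ)` and `k₁, …, k_m` are the auxiliary parameters of
Hermite's solutions of the Lamé equation `-ψ'' + m(m+1)℘(z)ψ = (λ/ω²)ψ`;
the latter condition is manifestly independent of `z₀`. -/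
theorem lameSpectrum_independent_of_z0_and_hermite_characterisation
    (W : WeierstrassData) (ω : ℂ) (hω : 2 * ω ∈ W.lattice) (hω' : ω ∉ W.lattice)
    (m : ℕ) (hm : 1 ≤ m)
    (z0 z0' : ℂ)
    (hz0 : ∀ x : ℝ, ω * x + z0 ∉ W.lattice)
    (hz0' : ∀ x : ℝ, ω * x + z0' ∉ W.lattice) :
    W.lameSpectrum m ω z0 = W.lameSpectrum m ω z0' ∧
    W.lameSpectrum m ω z0 =
      {lam : ℂ | ∃ kv : Fin m → ℂ, (∀ j, kv j ∉ W.lattice) ∧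
        (∀ z ∉ W.lattice,
          -deriv (deriv (hermiteProd W m kv)) z
            + (m * (m + 1) : ℂ) * W.P z * hermiteProd W m kv z
            = (lam / ω ^ 2) * hermiteProd W m kv z) ∧
        (W.Z ω * (∑ j, kv j) - ω * ∑ j, W.Z (kv j)).re = 0} := by
  exact ⟨(LameAux.spectrum_eq W hω hω' m hm hz0).trans (LameAux.spectrum_eq W hω hω' m hm hz0').symm,
    LameAux.spectrum_eq W hω hω' m hm hz0⟩
end
end

section
/- Let 𝓛 ⊂ ℂ be a lattice with Weierstrass functions ℘, ζ, let ω be a half-period and η = ζ(ω). Then u(k) = Re[ηk − ωζ(k)] is a well-defined real analytic function on the punctured elliptic curve 𝓔^× = (ℂ/𝓛) \ {0}; if moreover η + ωe_j ≠ 0 for j = 1,2,3 (where e_j = ℘(ω_j) are the half-period values of ℘), then u is a Morse function on 𝓔^× whose only critical points are ±k*, determined by η + ω℘(k*) = 0, and the Morse index of u at each of ±k* equals 1. -/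
open Complex Set Filter

noncomputable section

namespace WeierstrassData

open Topology

/-- The Mathlib period pair attached to the Weierstrass data. -/
def pp (W : WeierstrassData) : PeriodPair where
  ω₁ := 2 * W.w1
  ω₂ := 2 * W.w3
  indep := by
    rw [LinearIndependent.pair_iff]
    intro s t h
    have h2 : (s : ℂ) * W.w1 + t * W.w3 = 0 := by
      have : (2:ℂ) * ((s : ℂ) * W.w1 + t * W.w3) = 0 := by
        rw [← h]; simp only [Complex.real_smul]; ring
      simpa using this
    have ht : t = 0 := by
      by_contra ht
      apply W.indep (-s / t)
      have ht' : (t : ℂ) ≠ 0 := by exact_mod_cast ht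
      push_cast
      field_simp
      linear_combination h2
    subst ht
    have hs : (s : ℂ) * W.w1 = 0 := by simpa using h2
    rcases mul_eq_zero.mp hs with h | h
    · exact ⟨by exact_mod_cast h, rfl⟩
    · exact absurd h W.w1_ne

lemma mem_lat_iff (W : WeierstrassData) (z : ℂ) : z ∈ W.lattice ↔ z ∈ W.pp.lattice := by
  rw [PeriodPair.mem_lattice]
  constructor
  · rintro ⟨m, n, rfl⟩
    exact ⟨m, n, by simp only [pp]; ring⟩
  · rintro ⟨m, n, rfl⟩
    exact ⟨m, n, by simp only [pp]; ring⟩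

lemma lat_eq (W : WeierstrassData) : W.lattice = (W.pp.lattice : Set ℂ) := by
  ext z; exact W.mem_lat_iff z

lemma zero_mem (W : WeierstrassData) : (0 : ℂ) ∈ W.lattice := by
  rw [mem_lat_iff]; exact Submodule.zero_mem _

lemma add_mem (W : WeierstrassData) {a b : ℂ} (ha : a ∈ W.lattice) (hb : b ∈ W.lattice) :
    a + b ∈ W.lattice := by
  rw [mem_lat_iff] at *; exact Submodule.add_mem _ ha hb

lemma sub_mem (W : WeierstrassData) {a b : ℂ} (ha : a ∈ W.lattice) (hb : b ∈ W.lattice) :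
    a - b ∈ W.lattice := by
  rw [mem_lat_iff] at *; exact Submodule.sub_mem _ ha hb

lemma neg_mem (W : WeierstrassData) {a : ℂ} (ha : a ∈ W.lattice) :
    -a ∈ W.lattice := by
  rw [mem_lat_iff] at *; exact Submodule.neg_mem _ ha

lemma add_notMem (W : WeierstrassData) {a b : ℂ} (ha : a ∉ W.lattice) (hb : b ∈ W.lattice) :
    a + b ∉ W.lattice := fun h => ha (by simpa using W.sub_mem h hb)

lemma neg_notMem (W : WeierstrassData) {a : ℂ} (ha : a ∉ W.lattice) :
    -a ∉ W.lattice := fun h => ha (by simpa using W.neg_mem h)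

lemma isOpen_compl (W : WeierstrassData) : IsOpen (W.latticeᶜ) := by
  rw [lat_eq]; exact W.pp.isClosed_lattice.isOpen_compl

lemma punctured (W : WeierstrassData) : ∀ᶠ z in 𝓝[≠] (0 : ℂ), z ∉ W.lattice := by
  have h := W.pp.compl_lattice_sdiff_singleton_mem_nhds 0
  filter_upwards [mem_nhdsWithin_of_mem_nhds h, self_mem_nhdsWithin] with z hz hz0
  rw [mem_lat_iff]
  exact fun hm => hz ⟨hm, hz0⟩

lemma countable_lat (W : WeierstrassData) : W.lattice.Countable := by
  have : W.lattice = Set.range (fun p : ℤ × ℤ => 2 * (p.1 : ℂ) * W.w1 + 2 * p.2 * W.w3) := by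
    ext z
    constructor
    · rintro ⟨m, n, rfl⟩; exact ⟨(m, n), rfl⟩
    · rintro ⟨⟨m, n⟩, rfl⟩; exact ⟨m, n, rfl⟩
  rw [this]; exact Set.countable_range _

lemma preconnected (W : WeierstrassData) : IsPreconnected (W.latticeᶜ) :=
  (W.countable_lat.isConnected_compl_of_one_lt_rank (by simp)).isPreconnected

lemma const_of_deriv (W : WeierstrassData) {f : ℂ → ℂ}
    (hf : ∀ z ∉ W.lattice, HasDerivAt f 0 z) : ∃ c, ∀ z ∉ W.lattice, f z = c :=
  W.isOpen_compl.exists_is_const_of_deriv_eq_zero W.preconnected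
    (fun z hz => (hf z hz).differentiableAt.differentiableWithinAt)
    (fun z hz => (hf z hz).deriv)

lemma hasDeriv_Z (W : WeierstrassData) {z : ℂ} (hz : z ∉ W.lattice) :
    HasDerivAt W.Z (-W.P z) z := by
  rw [← W.Z_deriv z hz]; exact (W.Z_diff z hz).hasDerivAt

lemma hasDeriv_S (W : WeierstrassData) {z : ℂ} (hz : z ∉ W.lattice) :
    HasDerivAt W.S (W.Z z * W.S z) z := by
  rw [← W.S_deriv z hz]; exact (W.S_diff z).hasDerivAt

lemma P_even (W : WeierstrassData) {z : ℂ} (hz : z ∉ W.lattice) : W.P (-z) = W.P z := by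
  have h1 : HasDerivAt (fun x => W.Z (-x)) (-(-W.P (-z))) z := by
    have := (W.hasDeriv_Z (W.neg_notMem hz)).scomp z (hasDerivAt_neg z)
    simpa [Function.comp_def] using this
  have h2 : HasDerivAt (fun x => W.Z (-x)) (-(-W.P z)) z := by
    have := (W.hasDeriv_Z hz).neg
    refine this.congr_of_eventuallyEq (Eventually.of_forall fun x => ?_)
    simp [W.Z_odd]
  simpa using h1.unique h2

lemma Z_quasi (W : WeierstrassData) {w : ℂ} (hw : w ∈ W.lattice) :
    ∃ c, ∀ z ∉ W.lattice, W.Z (z + w) = W.Z z + c := by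
  obtain ⟨c, hc⟩ := W.const_of_deriv (f := fun z => W.Z (z + w) - W.Z z) (by
    intro z hz
    have h1 := (W.hasDeriv_Z (W.add_notMem hz hw)).comp_add_const z w
    have := h1.sub (W.hasDeriv_Z hz)
    exact this.congr_deriv (by rw [W.P_periodic w hw]; ring))
  exact ⟨c, fun z hz => by rw [← hc z hz]; ring⟩

lemma S_quasi (W : WeierstrassData) {w c : ℂ} (hw : w ∈ W.lattice)
    (hc : ∀ z ∉ W.lattice, W.Z (z + w) = W.Z z + c) :
    ∃ C, C ≠ 0 ∧ ∀ z ∉ W.lattice, W.S (z + w) = C * exp (c * z) * W.S z := by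
  obtain ⟨C, hC⟩ := W.const_of_deriv (f := fun z => W.S (z + w) / (exp (c * z) * W.S z)) (by
    intro z hz
    have hS := W.S_ne z hz
    have h1 := (W.hasDeriv_S (W.add_notMem hz hw)).comp_add_const z w
    have h3 : HasDerivAt (fun z => exp (c * z)) (exp (c * z) * c) z := by
      simpa using ((hasDerivAt_id z).const_mul c).cexp
    have h4 := h1.div (h3.mul (W.hasDeriv_S hz)) (mul_ne_zero (exp_ne_zero _) hS)
    refine h4.congr_deriv ?_
    rw [hc z hz]
    simp only [Pi.mul_apply]
    rw [div_eq_zero_iff]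
    left
    ring)
  have key : ∀ z ∉ W.lattice, W.S (z + w) = C * exp (c * z) * W.S z := by
    intro z hz
    rw [← hC z hz]
    have hS := W.S_ne z hz
    have := exp_ne_zero (c * z)
    field_simp
  refine ⟨C, ?_, key⟩
  rintro rfl
  obtain ⟨z, hz⟩ := W.punctured.exists
  have := key z hz
  simp at this
  exact W.S_ne _ (W.add_notMem hz hw) this

/-- Legendre relation (real-part form). -/
lemma legendre (W : WeierstrassData) {w c w' c' : ℂ} (hw : w ∈ W.lattice) (hw' : w' ∈ W.lattice)
    (hc : ∀ z ∉ W.lattice, W.Z (z + w) = W.Z z + c)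
    (hc' : ∀ z ∉ W.lattice, W.Z (z + w') = W.Z z + c') : (c * w' - c' * w).re = 0 := by
  obtain ⟨C, hC0, hC⟩ := W.S_quasi hw hc
  obtain ⟨C', hC0', hC'⟩ := W.S_quasi hw' hc'
  obtain ⟨z, hz⟩ := W.punctured.exists
  have e1 := hC (z + w') (W.add_notMem hz hw')
  have e2 := hC' (z + w) (W.add_notMem hz hw)
  rw [hC' z hz] at e1
  rw [hC z hz, add_right_comm, e1, mul_add, mul_add, exp_add, exp_add] at e2
  have hS := W.S_ne z hz
  have h1 := exp_ne_zero (c * z)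
  have h2 := exp_ne_zero (c' * z)
  have h3 : exp (c * w') = exp (c' * w) := by
    have hne : C * C' * exp (c * z) * exp (c' * z) * W.S z ≠ 0 := by positivity
    apply mul_left_cancel₀ hne
    linear_combination e2
  have h4 : exp (c * w' - c' * w) = 1 := by
    rw [exp_sub, h3, div_self (exp_ne_zero _)]
  have h5 := congrArg norm h4
  rw [norm_exp, norm_one, Real.exp_eq_one_iff] at h5
  exact h5

lemma Z_half (W : WeierstrassData) {ω : ℂ} (hω : 2 * ω ∈ W.lattice) (hω' : ω ∉ W.lattice) :
    ∀ z ∉ W.lattice, W.Z (z + 2 * ω) = W.Z z + 2 * W.Z ω := by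
  obtain ⟨c, hc⟩ := W.Z_quasi hω
  have := hc (-ω) (W.neg_notMem hω')
  rw [W.Z_odd, show -ω + 2 * ω = ω by ring] at this
  intro z hz
  rw [hc z hz]
  linear_combination -this

lemma u_periodic (W : WeierstrassData) {ω : ℂ} (hω : 2 * ω ∈ W.lattice) (hω' : ω ∉ W.lattice) :
    ∀ k ∉ W.lattice, ∀ w ∈ W.lattice, W.uFun ω (k + w) = W.uFun ω k := by
  intro k hk w hw
  obtain ⟨c, hc⟩ := W.Z_quasi hw
  have h := W.legendre hw hω hc (W.Z_half hω hω')
  unfold uFun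
  rw [hc k hk]
  have : W.Z ω * (k + w) - ω * (W.Z k + c) = (W.Z ω * k - ω * W.Z k)
      - ((1/2 : ℝ) : ℂ) * (c * (2 * ω) - 2 * W.Z ω * w) := by push_cast; ring
  rw [this, sub_re, re_ofReal_mul, h]; simp

lemma liouville (W : WeierstrassData) {f : ℂ → ℂ} {l : ℂ}
    (hd : ∀ z ∉ W.lattice, DifferentiableAt ℂ f z)
    (hp : ∀ z ∉ W.lattice, ∀ w ∈ W.lattice, f (z + w) = f z)
    (hl : Tendsto f (𝓝[≠] 0) (𝓝 l)) : ∀ z ∉ W.lattice, f z = l := by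
  classical
  set g : ℂ → ℂ := fun z => if z ∈ W.lattice then l else f z with hg
  have hgp : ∀ z, ∀ w ∈ W.lattice, g (z + w) = g z := by
    intro z w hw
    by_cases hz : z ∈ W.lattice
    · simp [hg, hz, W.add_mem hz hw]
    · simp [hg, hz, W.add_notMem hz hw, hp z hz w hw]
  have hgd' : ∀ z ∉ W.lattice, DifferentiableAt ℂ g z := by
    intro z hz
    refine (hd z hz).congr_of_eventuallyEq ?_
    filter_upwards [W.isOpen_compl.mem_nhds hz] with x hx
    exact if_neg hx
  have hg0 : DifferentiableAt ℂ g 0 := by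
    refine (Complex.analyticAt_of_differentiable_on_punctured_nhds_of_continuousAt
      (W.punctured.mono hgd') ?_).differentiableAt
    rw [continuousAt_iff_punctured_nhds]
    have : g 0 = l := if_pos W.zero_mem
    rw [this]
    refine hl.congr' ?_
    filter_upwards [W.punctured] with x hx
    exact (if_neg hx).symm
  have hgd : Differentiable ℂ g := by
    intro z
    by_cases hz : z ∈ W.lattice
    · have h1 : g = fun x => g (x - z) := by
        funext x
        have := hgp (x - z) z hz
        simpa using this
      rw [h1]
      have : DifferentiableAt ℂ g (z - z) := by rw [sub_self]; exact hg0
      exact this.comp z (f := fun x => x - z) (by fun_prop)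
    · exact hgd' z hz
  intro z hz
  have h := hgd.apply_eq_apply_of_bounded (IsZLattice.isCompact_range_of_periodic W.pp.lattice _
    hgd.continuous fun z w hw => hgp z w ((W.mem_lat_iff w).2 hw)).isBounded z 0
  simpa [hg, hz, W.zero_mem] using h

lemma z_sq_P (W : WeierstrassData) : Tendsto (fun z => z ^ 2 * W.P z) (𝓝[≠] 0) (𝓝 1) := by
  have hz : Tendsto (fun z : ℂ => z ^ 2) (𝓝[≠] 0) (𝓝 0) := by
    have : ContinuousAt (fun z : ℂ => z ^ 2) 0 := by fun_prop
    simpa using this.tendsto.mono_left nhdsWithin_le_nhds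
  have h := (hz.mul W.P_pole).add_const 1
  simp only [mul_zero, zero_add] at h
  refine h.congr' ?_
  filter_upwards [self_mem_nhdsWithin] with z hz
  have : z ≠ 0 := hz
  field_simp
  ring

lemma P_surj (W : WeierstrassData) (c : ℂ) : ∃ k, k ∉ W.lattice ∧ W.P k = c := by
  by_contra hcon
  push Not at hcon
  have hz : Tendsto (fun z : ℂ => z ^ 2) (𝓝[≠] 0) (𝓝 0) := by
    have : ContinuousAt (fun z : ℂ => z ^ 2) 0 := by fun_prop
    simpa using this.tendsto.mono_left nhdsWithin_le_nhds
  have h := W.liouville (f := fun z => (W.P z - c)⁻¹) (l := 0)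
    (fun z hz => ((W.P_diff z hz).sub_const c).inv (sub_ne_zero.2 (hcon z hz)))
    (fun z _ w hw => by simp only [W.P_periodic w hw])
    (by
      have h1 := hz.div (W.z_sq_P.sub (hz.mul_const c)) (by simp)
      simp only [zero_mul, sub_zero, div_one] at h1
      refine h1.congr' ?_
      filter_upwards [self_mem_nhdsWithin, W.punctured] with z hz hzl
      have : z ≠ 0 := hz
      have := sub_ne_zero.2 (hcon z hzl)
      simp only [Pi.div_apply]
      rw [show z ^ 2 * W.P z - z ^ 2 * c = z ^ 2 * (W.P z - c) by ring]
      field_simp)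
  obtain ⟨z, hz⟩ := W.punctured.exists
  exact inv_ne_zero (sub_ne_zero.2 (hcon z hz)) (h z hz)

lemma S_zero (W : WeierstrassData) : W.S 0 = 0 := by
  have h1 : Tendsto W.S (𝓝[≠] 0) (𝓝 (W.S 0)) :=
    (W.S_diff 0).continuousAt.tendsto.mono_left nhdsWithin_le_nhds
  have h2 : Tendsto (fun z : ℂ => z) (𝓝[≠] 0) (𝓝 0) :=
    tendsto_id.mono_left nhdsWithin_le_nhds
  have h3 := W.S_norm.mul h2
  simp only [mul_zero] at h3
  refine tendsto_nhds_unique h1 (h3.congr' ?_)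
  filter_upwards [self_mem_nhdsWithin] with z hz
  have : z ≠ 0 := hz
  field_simp

lemma hasDeriv_S_zero (W : WeierstrassData) : HasDerivAt W.S 1 0 := by
  rw [hasDerivAt_iff_tendsto_slope]
  refine W.S_norm.congr fun z => ?_
  simp [slope_def_field, W.S_zero]

lemma S_odd (W : WeierstrassData) (z : ℂ) (hz : z ∉ W.lattice) : W.S (-z) = - W.S z := by
  obtain ⟨C, hC⟩ := W.const_of_deriv (f := fun z => W.S (-z) / W.S z) (by
    intro z hz
    have h1 := (W.hasDeriv_S (W.neg_notMem hz)).scomp z (hasDerivAt_neg z)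
    have h2 := h1.div (W.hasDeriv_S hz) (W.S_ne z hz)
    refine h2.congr_deriv ?_
    rw [W.Z_odd]
    simp only [Function.comp_apply, smul_eq_mul]
    rw [div_eq_zero_iff]
    left
    ring)
  have hneg : Tendsto (fun z : ℂ => -z) (𝓝[≠] 0) (𝓝[≠] 0) := by
    refine tendsto_nhdsWithin_of_tendsto_nhds_of_eventually_within _ ?_ ?_
    · have : ContinuousAt (fun z : ℂ => -z) 0 := by fun_prop
      simpa using this.tendsto.mono_left nhdsWithin_le_nhds
    · filter_upwards [self_mem_nhdsWithin] with z hz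
      simpa using hz
  have h1 := ((W.S_norm.comp hneg).div W.S_norm one_ne_zero).neg
  have h2 : C = -1 := by
    have hcc : Tendsto (fun _ : ℂ => C) (𝓝[≠] (0:ℂ)) (𝓝 (-(1/1))) := by
      refine h1.congr' ?_
      filter_upwards [self_mem_nhdsWithin, W.punctured] with z hz hzl
      have : z ≠ 0 := hz
      have := W.S_ne z hzl
      rw [← hC z hzl]
      simp only [Function.comp_apply, Pi.div_apply]
      field_simp
    simpa using tendsto_nhds_unique tendsto_const_nhds hcc
  have := hC z hz
  rw [h2, div_eq_iff (W.S_ne z hz)] at this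
  rw [this]; ring

/-- An even function, holomorphic in a punctured neighbourhood of `0`, with `z² G → 0`,
has a removable singularity. -/
lemma even_removable {G : ℂ → ℂ} (hd : ∀ᶠ z in 𝓝[≠] (0:ℂ), DifferentiableAt ℂ G z)
    (he : ∀ᶠ z in 𝓝[≠] (0:ℂ), G (-z) = G z)
    (hl : Tendsto (fun z => z ^ 2 * G z) (𝓝[≠] 0) (𝓝 0)) : ∃ l, Tendsto G (𝓝[≠] 0) (𝓝 l) := by
  set F : ℂ → ℂ := fun z => z ^ 2 * G z with hF
  have hF0 : F 0 = 0 := by simp [hF]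
  have hFa : AnalyticAt ℂ F 0 := by
    refine Complex.analyticAt_of_differentiable_on_punctured_nhds_of_continuousAt
      (hd.mono fun z hz => ?_) ?_
    · exact DifferentiableAt.mul (by fun_prop) hz
    · rw [continuousAt_iff_punctured_nhds, hF0]; exact hl
  have hFd := hFa.differentiableAt.hasDerivAt
  have hFe : ∀ᶠ z in 𝓝 (0:ℂ), F (-z) = F z := by
    rw [eventually_nhdsWithin_iff] at he
    filter_upwards [he] with z hz
    by_cases h : z = 0
    · simp [h]
    · simp only [hF, hz h]; ring
  have hFd0 : deriv F 0 = 0 := by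
    have h1 : HasDerivAt (fun z => F (-z)) (-deriv F 0) 0 := by
      have h0 : HasDerivAt F (deriv F 0) (-0) := by rw [neg_zero]; exact hFd
      have := h0.scomp (0:ℂ) (hasDerivAt_neg (0:ℂ))
      simpa [Function.comp_def] using this
    have h2 : HasDerivAt F (-deriv F 0) 0 :=
      h1.congr_of_eventuallyEq (hFe.mono fun z hz => hz.symm)
    have := h2.unique hFd
    linear_combination (-1/2 : ℂ) * this
  rw [hFd0, hasDerivAt_iff_tendsto_slope] at hFd
  have hzG : Tendsto (fun z => z * G z) (𝓝[≠] 0) (𝓝 0) := by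
    refine hFd.congr' ?_
    filter_upwards [self_mem_nhdsWithin] with z hz
    have : z ≠ 0 := hz
    rw [slope_def_field, hF0, sub_zero, sub_zero]
    simp only [hF]
    field_simp
  refine ⟨_, Complex.tendsto_limUnder_of_differentiable_on_punctured_nhds_of_isLittleO hd ?_⟩
  rw [Asymptotics.isLittleO_iff_tendsto']
  · have hz : Tendsto (fun z : ℂ => z) (𝓝[≠] 0) (𝓝 0) :=
      tendsto_id.mono_left nhdsWithin_le_nhds
    have := hzG.sub (hz.mul_const (G 0))
    simp only [zero_mul, sub_zero] at this
    refine this.congr fun z => ?_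
    simp only [sub_zero, div_inv_eq_mul]; ring
  · filter_upwards [self_mem_nhdsWithin] with z hz h
    have : z ≠ 0 := hz
    simp [this] at h

/-- The elliptic function `σ(z-a)σ(z+a)/σ(z)²`. -/
def hfun (W : WeierstrassData) (a z : ℂ) : ℂ := W.S (z - a) * W.S (z + a) / W.S z ^ 2

lemma hfun_diff (W : WeierstrassData) (a : ℂ) {z : ℂ} (hz : z ∉ W.lattice) :
    DifferentiableAt ℂ (W.hfun a) z := by
  unfold hfun
  have := W.S_diff
  exact DifferentiableAt.div (by fun_prop) (by fun_prop) (pow_ne_zero _ (W.S_ne z hz))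

lemma S_quasi_all (W : WeierstrassData) {w c C : ℂ}
    (hC : ∀ z ∉ W.lattice, W.S (z + w) = C * exp (c * z) * W.S z) (z : ℂ) :
    W.S (z + w) = C * exp (c * z) * W.S z := by
  have hS := W.S_diff.continuous
  have hdense : Dense (W.latticeᶜ) := W.countable_lat.dense_compl ℝ
  have := Continuous.ext_on hdense (f := fun z => W.S (z + w))
    (g := fun z => C * exp (c * z) * W.S z) (by fun_prop) (by fun_prop) (fun z hz => hC z hz)
  exact congrFun this z

lemma hfun_periodic (W : WeierstrassData) (a : ℂ) {z w : ℂ} (hz : z ∉ W.lattice)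
    (hw : w ∈ W.lattice) : W.hfun a (z + w) = W.hfun a z := by
  obtain ⟨c, hc⟩ := W.Z_quasi hw
  obtain ⟨C, hC0, hC⟩ := W.S_quasi hw hc
  have hC' := W.S_quasi_all hC
  unfold hfun
  rw [show z + w - a = (z - a) + w by ring, show z + w + a = (z + a) + w by ring,
    hC', hC', hC']
  have e : exp (c * (z - a)) * exp (c * (z + a)) = exp (c * z) ^ 2 := by
    rw [← exp_add, ← exp_nat_mul]; congr 1; push_cast; ring
  have hS := W.S_ne z hz
  have := exp_ne_zero (c * z)
  rw [div_eq_div_iff (by positivity) (by positivity)]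
  linear_combination C ^ 2 * W.S (z - a) * W.S (z + a) * W.S z ^ 2 * e

lemma S_odd_all (W : WeierstrassData) (z : ℂ) : W.S (-z) = - W.S z := by
  have hS := W.S_diff.continuous
  have hdense : Dense (W.latticeᶜ) := W.countable_lat.dense_compl ℝ
  have := Continuous.ext_on hdense (f := fun z => W.S (-z))
    (g := fun z => - W.S z) (by fun_prop) (by fun_prop) (fun z hz => W.S_odd z hz)
  exact congrFun this z

lemma hfun_even (W : WeierstrassData) (a z : ℂ) : W.hfun a (-z) = W.hfun a z := by
  unfold hfun
  rw [show -z - a = -(z + a) by ring, show -z + a = -(z - a) by ring]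
  simp only [W.S_odd_all]
  ring

lemma P_sub (W : WeierstrassData) {a : ℂ} (ha : a ∉ W.lattice) :
    ∀ z ∉ W.lattice, W.S a ^ 2 * (W.P z - W.P a) = - W.hfun a z := by
  set G : ℂ → ℂ := fun z => W.S a ^ 2 * W.P z + W.hfun a z with hG
  have hd : ∀ z ∉ W.lattice, DifferentiableAt ℂ G z := fun z hz =>
    ((W.P_diff z hz).const_mul _).add (W.hfun_diff a hz)
  have hz2 : Tendsto (fun z => z ^ 2 * W.hfun a z) (𝓝[≠] 0) (𝓝 (-W.S a ^ 2)) := by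
    have hS := W.S_diff.continuous
    have h1 : Tendsto (fun z => W.S (z - a) * W.S (z + a)) (𝓝[≠] 0) (𝓝 (-W.S a ^ 2)) := by
      have : Continuous (fun z => W.S (z - a) * W.S (z + a)) := by fun_prop
      have := (this.tendsto 0).mono_left (nhdsWithin_le_nhds (s := {0}ᶜ))
      simp only [zero_sub, zero_add, W.S_odd_all] at this
      convert this using 2
      ring
    have h2 := h1.div (W.S_norm.pow 2) (by simp)
    simp only [one_pow, div_one] at h2
    refine h2.congr' ?_
    filter_upwards [self_mem_nhdsWithin, W.punctured] with z hz hzl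
    have : z ≠ 0 := hz
    have := W.S_ne z hzl
    simp only [hfun, Pi.div_apply]
    field_simp
  obtain ⟨l, hl⟩ := even_removable (G := G) (W.punctured.mono hd)
    (W.punctured.mono fun z hz => by simp only [hG, W.P_even hz, W.hfun_even])
    (by
      have := (W.z_sq_P.const_mul (W.S a ^ 2)).add hz2
      rw [mul_one, add_neg_cancel] at this
      refine this.congr fun z => ?_
      simp only [hG]; ring)
  have hc := W.liouville hd (fun z hz w hw => by
    simp only [hG, W.P_periodic w hw, W.hfun_periodic a hz hw]) hl
  intro z hz
  have h1 := hc z hz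
  have h2 := hc a ha
  have h3 : W.hfun a a = 0 := by simp [hfun, W.S_zero]
  simp only [hG] at h1 h2
  rw [h3] at h2
  linear_combination h1 - h2

lemma P_eq_iff (W : WeierstrassData) {a z : ℂ} (ha : a ∉ W.lattice) (hz : z ∉ W.lattice) :
    W.P z = W.P a ↔ ∃ w ∈ W.lattice, z = a + w ∨ z = -a + w := by
  constructor
  · intro h
    have h1 := W.P_sub ha z hz
    rw [h, sub_self, mul_zero, eq_comm, neg_eq_zero, hfun, div_eq_zero_iff, mul_eq_zero] at h1
    rcases h1 with (h1 | h1) | h1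
    · exact ⟨z - a, by_contra fun hn => W.S_ne _ hn h1, Or.inl (by ring)⟩
    · exact ⟨z + a, by_contra fun hn => W.S_ne _ hn h1, Or.inr (by ring)⟩
    · exact absurd h1 (pow_ne_zero _ (W.S_ne z hz))
  · rintro ⟨w, hw, rfl | rfl⟩
    · rw [W.P_periodic w hw]
    · rw [W.P_periodic w hw, W.P_even ha]

lemma deriv_P_ne (W : WeierstrassData) {a : ℂ} (ha : a ∉ W.lattice) (h2a : 2 * a ∉ W.lattice) :
    deriv W.P a ≠ 0 := by
  have hSd := W.S_diff
  have hSa := W.S_ne a ha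
  have hS2a := W.S_ne _ h2a
  set q : ℂ → ℂ := fun z => W.S (z + a) / W.S z ^ 2 with hq
  have hqd : DifferentiableAt ℂ q a :=
    DifferentiableAt.div (by fun_prop) (by fun_prop) (pow_ne_zero _ hSa)
  have h0 : HasDerivAt (fun z => W.S (z - a)) 1 a := by
    have : HasDerivAt W.S 1 (a - a) := by rw [sub_self]; exact W.hasDeriv_S_zero
    exact this.comp_sub_const a a
  have h1 := (h0.mul hqd.hasDerivAt).neg
  have h2 := ((W.P_diff a ha).hasDerivAt.sub_const (W.P a)).const_mul (W.S a ^ 2)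
  have h3 := h1.congr_of_eventuallyEq
    (f₁ := fun z => W.S a ^ 2 * (W.P z - W.P a)) (by
      filter_upwards [W.isOpen_compl.mem_nhds ha] with z hz
      rw [W.P_sub ha z hz]
      simp only [hfun, hq, Pi.neg_apply, Pi.mul_apply]
      ring)
  have h4 := h2.unique h3
  intro h
  rw [h] at h4
  simp only [sub_self, W.S_zero, zero_mul, one_mul, mul_zero, add_zero, hq, ← two_mul] at h4
  rw [eq_comm, neg_eq_zero, div_eq_zero_iff] at h4
  rcases h4 with h4 | h4
  · exact hS2a h4
  · exact pow_ne_zero _ hSa h4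

lemma half_cases (W : WeierstrassData) {k : ℂ} (hk : k ∉ W.lattice) (h2 : 2 * k ∈ W.lattice) :
    W.P k = W.e1 ∨ W.P k = W.e2 ∨ W.P k = W.e3 := by
  obtain ⟨m, n, h⟩ := h2
  have h' : k = m * W.w1 + n * W.w3 := by linear_combination h / 2
  rcases Int.even_or_odd' m with ⟨m', rfl | rfl⟩ <;> rcases Int.even_or_odd' n with ⟨n', rfl | rfl⟩
  · exact absurd ⟨m', n', by rw [h']; push_cast; ring⟩ hk
  · right; right
    rw [e3, ← W.P_periodic _ ⟨m', n', rfl⟩ (W.w3), h']; congr 1; push_cast; ring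
  · left
    rw [e1, ← W.P_periodic _ ⟨m', n', rfl⟩ (W.w1), h']; congr 1; push_cast; ring
  · right; left
    rw [e2, ← W.P_periodic _ ⟨m', n', rfl⟩ (W.w2), h', w2]; congr 1; push_cast; ring

lemma analytic_Z (W : WeierstrassData) {k : ℂ} (hk : k ∉ W.lattice) : AnalyticAt ℂ W.Z k :=
  DifferentiableOn.analyticAt (s := W.latticeᶜ)
    (fun z hz => (W.Z_diff z hz).differentiableWithinAt) (W.isOpen_compl.mem_nhds hk)

lemma u_analytic (W : WeierstrassData) (ω : ℂ) {k : ℂ} (hk : k ∉ W.lattice) :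
    AnalyticAt ℝ (W.uFun ω) k := by
  have h1 : AnalyticAt ℂ (fun k => W.Z ω * k - ω * W.Z k) k := by
    have := W.analytic_Z hk
    fun_prop
  exact (Complex.reCLM.analyticAt _).comp (f := fun k => W.Z ω * k - ω * W.Z k)
    (h1.restrictScalars (𝕜 := ℝ))

/-- The real-linear functional `v ↦ Re (c v)`, depending linearly on `c`. -/
def reMul : ℂ →L[ℝ] (ℂ →L[ℝ] ℝ) :=
  (ContinuousLinearMap.compL ℝ ℂ ℂ ℝ Complex.reCLM).comp (ContinuousLinearMap.mul ℝ ℂ)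

lemma reMul_apply (c v : ℂ) : reMul c v = (c * v).re := rfl

lemma u_fderiv (W : WeierstrassData) (ω : ℂ) {k : ℂ} (hk : k ∉ W.lattice) :
    HasFDerivAt (W.uFun ω) (reMul (W.Z ω + ω * W.P k)) k := by
  have h1 : HasDerivAt (fun k => W.Z ω * k - ω * W.Z k) (W.Z ω + ω * W.P k) k := by
    have := ((hasDerivAt_id k).const_mul (W.Z ω)).sub ((W.hasDeriv_Z hk).const_mul ω)
    exact this.congr_deriv (by ring)
  have h2 := Complex.reCLM.hasFDerivAt.comp k (h1.hasFDerivAt.restrictScalars ℝ)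
  refine HasFDerivAt.congr_fderiv (f := W.uFun ω) h2 ?_
  ext v
  simp [reMul_apply]
  ring

lemma reMul_eq_zero {c : ℂ} : reMul c = 0 ↔ c = 0 := by
  constructor
  · intro h
    have h1 : reMul c (starRingEnd ℂ c) = 0 := by rw [h]; rfl
    rw [reMul_apply, mul_conj, ofReal_re] at h1
    exact normSq_eq_zero.1 h1
  · rintro rfl; simp

lemma u_hess (W : WeierstrassData) (ω : ℂ) {k : ℂ} (hk : k ∉ W.lattice) (v v' : ℂ) :
    fderiv ℝ (fderiv ℝ (W.uFun ω)) k v v' = (ω * deriv W.P k * v * v').re := by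
  have h0 : HasDerivAt (fun k => W.Z ω + ω * W.P k) (ω * deriv W.P k) k :=
    ((W.P_diff k hk).hasDerivAt.const_mul ω).const_add _
  have h1 := reMul.hasFDerivAt.comp k (h0.hasFDerivAt.restrictScalars ℝ)
  have h2 := h1.congr_of_eventuallyEq (f₁ := fderiv ℝ (W.uFun ω)) (by
    filter_upwards [W.isOpen_compl.mem_nhds hk] with z hz
    exact (W.u_fderiv ω hz).fderiv)
  rw [h2.fderiv]
  simp only [ContinuousLinearMap.comp_apply, reMul_apply]
  congr 2
  simp [mul_comm]

end WeierstrassData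

/-- `u(k) = Re[ηk - ωζ(k)]` is a well-defined real analytic
function on the punctured torus `𝓔^× = (ℂ/𝓛) \ {0}`; under the non-degeneracy
conditions `η + ωeⱼ ≠ 0` (`j = 1,2,3`) it is a Morse function whose only
critical points are `±k*`, where `η + ω℘(k*) = 0`, and the Morse index at each
of `±k*` equals `1` (the Hessian is indefinite of signature `(1,1)`). -/
theorem uFun_welldefined_analytic_and_morse
    (W : WeierstrassData) (ω : ℂ) (hω : 2 * ω ∈ W.lattice) (hω' : ω ∉ W.lattice) :
    (∀ k ∉ W.lattice, ∀ w ∈ W.lattice, W.uFun ω (k + w) = W.uFun ω k) ∧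
    (∀ k ∉ W.lattice, AnalyticAt ℝ (W.uFun ω) k) ∧
    ((W.Z ω + ω * W.e1 ≠ 0 ∧ W.Z ω + ω * W.e2 ≠ 0 ∧ W.Z ω + ω * W.e3 ≠ 0) →
      ∃ kst : ℂ, kst ∉ W.lattice ∧ W.Z ω + ω * W.P kst = 0 ∧
        (∀ k ∉ W.lattice,
          (fderiv ℝ (W.uFun ω) k = 0 ↔ ∃ w ∈ W.lattice, k = kst + w ∨ k = -kst + w)) ∧
        (∀ k ∉ W.lattice, fderiv ℝ (W.uFun ω) k = 0 →
          ∃ v v' : ℂ, 0 < fderiv ℝ (fderiv ℝ (W.uFun ω)) k v v ∧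
            fderiv ℝ (fderiv ℝ (W.uFun ω)) k v' v' < 0)) := by
  refine ⟨W.u_periodic hω hω', fun k hk => W.u_analytic ω hk, ?_⟩
  rintro ⟨h1, h2, h3⟩
  have hω0 : ω ≠ 0 := fun h => hω' (h ▸ W.zero_mem)
  obtain ⟨a, ha, hPa⟩ := W.P_surj (-W.Z ω / ω)
  have hcrit : ∀ z, W.Z ω + ω * W.P z = 0 ↔ W.P z = W.P a := by
    intro z
    rw [hPa, eq_div_iff hω0]
    constructor <;> intro h <;> linear_combination h
  have hf : ∀ k ∉ W.lattice, (fderiv ℝ (W.uFun ω) k = 0 ↔ W.Z ω + ω * W.P k = 0) := by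
    intro k hk
    rw [(W.u_fderiv ω hk).fderiv, WeierstrassData.reMul_eq_zero]
  refine ⟨a, ha, (hcrit a).2 rfl, fun k hk => ?_, fun k hk hk0 => ?_⟩
  · rw [hf k hk, hcrit, W.P_eq_iff ha hk]
  · rw [hf k hk] at hk0
    have h2k : 2 * k ∉ W.lattice := by
      intro h
      rcases W.half_cases hk h with e | e | e <;> rw [e] at hk0
      · exact h1 hk0
      · exact h2 hk0
      · exact h3 hk0
    have hc : ω * deriv W.P k ≠ 0 := mul_ne_zero hω0 (W.deriv_P_ne hk h2k)
    obtain ⟨s, hs⟩ := IsAlgClosed.exists_pow_nat_eq (ω * deriv W.P k)⁻¹ (n := 2) (by norm_num)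
    have hs' : ω * deriv W.P k * s * s = 1 := by
      rw [mul_assoc, ← sq, hs, mul_inv_cancel₀ hc]
    refine ⟨s, I * s, ?_, ?_⟩
    · rw [W.u_hess ω hk, hs']; simp
    · rw [W.u_hess ω hk, show ω * deriv W.P k * (I * s) * (I * s)
        = (ω * deriv W.P k * s * s) * (I * I) by ring, hs', I_mul_I]; simp
end
end
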